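/- arXiv:2211.06357 — 2 statements merged into one kernel-verified Lean document; each statement's English description precedes it below -/
import Mathlib

section
/- Let G be a finite group and p a prime. Suppose the p-Sylow subgroup N of G is normal and cyclic, and that S_{G/N} ⊆ P_{G/N}. Then S_G ⊆ P_G. -/
open scoped BigOperators

noncomputable section

namespace Chars

/-- The permutation character `Ind_H^G 1` of `G` acting on the cosets `G ⧸ H`:
`g` is sent to the number of fixed points of `g` on `G ⧸ H`. -/
def permChar {G : Type} [Group G] (H : Subgroup G) : G → ℂ :=
  fun g => (Nat.card {x : G ⧸ H // g • x = x} : ℂ)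

open scoped Classical in
/-- The class function on `G` induced from a class function `f` on a subgroup `H`. -/
def indChar {G : Type} [Group G] [Finite G] (H : Subgroup G) (f : ↥H → ℂ) : G → ℂ :=
  fun g => (Nat.card ↥H : ℂ)⁻¹ *
    ∑ᶠ x : G, if h : x⁻¹ * g * x ∈ H then f ⟨x⁻¹ * g * x, h⟩ else 0

/-- The determinant character of a finite dimensional complex representation. -/
def detChar {G : Type} [Group G] (V : FDRep ℂ G) : G → ℂ :=
  fun g => LinearMap.det (V.ρ g)

/-- `χ` is a permutation (virtual) character: a `ℤ`-linear combination of the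
characters `Ind_H^G 1` of permutation representations. -/
def IsPermChar {G : Type} [Group G] (χ : G → ℂ) : Prop :=
  ∃ (k : ℕ) (Hs : Fin k → Subgroup G) (ns : Fin k → ℤ),
    χ = fun g => ∑ i, (ns i : ℂ) * permChar (Hs i) g

/-- `χ` is a virtual character: a difference of two genuine characters. -/
def IsVirtualChar {G : Type} [Group G] (χ : G → ℂ) : Prop :=
  ∃ V W : FDRep ℂ G, χ = V.character - W.character

/-- The virtual character `χ` has trivial determinant:  writing `χ = χ_V - χ_W`, the
determinant characters of `V` and `W` agree.  (The determinant of a virtual character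
is well defined, so this does not depend on the choice of decomposition.) -/
def HasTrivialDet {G : Type} [Group G] (χ : G → ℂ) : Prop :=
  ∃ V W : FDRep ℂ G, χ = V.character - W.character ∧ ∀ g, detChar V g = detChar W g

/-- The set `S_G` of permutation characters of `G` of degree `0` with trivial
determinant. -/
def MemS {G : Type} [Group G] (χ : G → ℂ) : Prop :=
  IsPermChar χ ∧ χ 1 = 0 ∧ HasTrivialDet χ

/-- The set `P_G`: the smallest set of (real valued) characters of `G` containing
`τ + τ̄` for every virtual character `τ` of degree `0`, containing
`Ind_H^G (τ - 1 - det τ)` for every subgroup `H ≤ G` and every degree `2` character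
`τ` of `H` factoring through a quotient of `H` isomorphic to `C₂ × C₂`, `D₈` or
`D_{2p}` (`p` an odd prime), and closed under `ℤ`-linear combinations. -/
inductive MemP (G : Type) [Group G] [Finite G] : (G → ℂ) → Prop where
  | selfConj (V W : FDRep ℂ G) (hdeg : V.character 1 = W.character 1) :
      MemP G ((V.character - W.character) + star (V.character - W.character))
  | dihedralInd (H : Subgroup G) (τ : FDRep ℂ ↥H) (hdeg : τ.character 1 = 2)
      (N : Subgroup ↥H) [hN : N.Normal]
      (hfac : ∀ n h : ↥H, n ∈ N → τ.character (n * h) = τ.character h)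
      (hquot : Nonempty (↥H ⧸ N ≃* Multiplicative (ZMod 2) × Multiplicative (ZMod 2)) ∨
               Nonempty (↥H ⧸ N ≃* DihedralGroup 4) ∨
               ∃ p : ℕ, p.Prime ∧ Odd p ∧ Nonempty (↥H ⧸ N ≃* DihedralGroup p)) :
      MemP G (indChar H (τ.character - 1 - detChar τ))
  | zero : MemP G 0
  | add {χ ψ : G → ℂ} : MemP G χ → MemP G ψ → MemP G (χ + ψ)
  | zsmul (n : ℤ) {χ : G → ℂ} : MemP G χ → MemP G (n • χ)

end Chars
open Chars

/-- An endomorphism of finite order of a complex vector space is diagonalizable. -/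
theorem Module.End.exists_eigenvalues_of_pow_eq_one {V : Type} [AddCommGroup V] [Module ℂ V]
    [FiniteDimensional ℂ V] (f : Module.End ℂ V) {m : ℕ} (hm : 0 < m) (hf : f ^ m = 1) :
    ∃ (n : ℕ) (d : Fin n → ℂ), (∀ i, d i ^ m = 1) ∧ LinearMap.det f = ∏ i, d i ∧
      ∀ k, LinearMap.trace ℂ V (f ^ k) = ∑ i, d i ^ k := by
  classical
  have hss : f.IsSemisimple := by
    refine Module.End.isSemisimple_of_squarefree_aeval_eq_zero
      (p := Polynomial.X ^ m - 1) ?_ (by simp [hf])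
    exact (Polynomial.separable_X_pow_sub_C (1 : ℂ) (by exact_mod_cast hm.ne')
      one_ne_zero).squarefree
  have hint : DirectSum.IsInternal f.eigenspace :=
    (DirectSum.isInternal_submodule_iff_iSupIndep_and_iSup_eq_top _).2
      ⟨f.eigenspaces_iSupIndep, hss.iSup_eigenspace_eq_top⟩
  let b₀ := hint.collectedBasis fun μ => Module.finBasis ℂ (f.eigenspace μ)
  have : Finite (Σ μ : ℂ, Fin (Module.finrank ℂ (f.eigenspace μ))) :=
    Module.Finite.finite_basis b₀
  let e := Finite.equivFin (Σ μ : ℂ, Fin (Module.finrank ℂ (f.eigenspace μ)))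
  let b := b₀.reindex e
  let d : Fin _ → ℂ := fun i => (e.symm i).1
  have hb : ∀ i, f (b i) = d i • b i := fun i => by
    have := hint.collectedBasis_mem (fun μ => Module.finBasis ℂ (f.eigenspace μ)) (e.symm i)
    simpa [b, b₀] using Module.End.mem_eigenspace_iff.1 this
  have hbk : ∀ k i, (f ^ k) (b i) = d i ^ k • b i := fun k i => by
    induction k with
    | zero => simp
    | succ k ih => rw [pow_succ', Module.End.mul_apply, ih, map_smul, hb, smul_smul, pow_succ]
  have hmat : ∀ k, LinearMap.toMatrix b b (f ^ k) = Matrix.diagonal fun i => d i ^ k := by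
    intro k
    ext i j
    rw [LinearMap.toMatrix_apply, hbk, map_smul, Finsupp.smul_apply, Module.Basis.repr_self,
      Matrix.diagonal_apply, Finsupp.single_apply]
    rcases eq_or_ne i j with rfl | h
    · simp
    · simp [h, h.symm]
  refine ⟨_, d, fun i => ?_, ?_, fun k => ?_⟩
  · have := hbk m i
    rw [hf, Module.End.one_apply] at this
    have h2 : (d i ^ m - 1) • b i = 0 := by rw [sub_smul, ← this, one_smul, sub_self]
    exact sub_eq_zero.1 ((smul_eq_zero.1 h2).resolve_right (b.ne_zero i))
  · have h1 := hmat 1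
    rw [pow_one] at h1
    rw [← LinearMap.det_toMatrix b, h1]
    simp
  · rw [LinearMap.trace_eq_matrix_trace ℂ b, hmat]
    simp

theorem Complex.sum_range_pow_of_pow_eq_one {m : ℕ} {z : ℂ} (hz : z ^ m = 1) :
    ∑ k ∈ Finset.range m, z ^ k = if z = 1 then (m : ℂ) else 0 := by
  split_ifs with h
  · simp [h]
  · rw [geom_sum_eq h, hz, sub_self, zero_div]

/-- Multiplicities of eigenvalues of an element of finite order from its power sums. -/
theorem Complex.sum_range_powerSum {m n : ℕ} (hm : 0 < m) {d : Fin n → ℂ}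
    (hd : ∀ i, d i ^ m = 1) {z : ℂ} (hz : z ^ m = 1) :
    ∑ k ∈ Finset.range m, (∑ i, d i ^ k) * z⁻¹ ^ k =
      m * (Finset.univ.filter fun i => d i = z).card := by
  have hz0 : z ≠ 0 := by rintro rfl; simp [hm.ne'] at hz
  simp_rw [Finset.sum_mul]
  rw [Finset.sum_comm]
  simp_rw [← mul_pow]
  rw [Finset.sum_congr rfl fun i _ => Complex.sum_range_pow_of_pow_eq_one
    (z := d i * z⁻¹) (by rw [mul_pow, inv_pow, hd, hz]; simp)]
  simp_rw [mul_inv_eq_one₀ hz0]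
  rw [← Finset.sum_filter, Finset.sum_const, nsmul_eq_mul, mul_comm]

/-- Two lists of roots of unity of the same length, the difference of whose power sums is real,
have products that agree up to a sign given by the multiplicities of the eigenvalue `1`. -/
theorem Complex.prod_eq_of_powerSum_real {m n : ℕ} (hm : 0 < m) {d e : Fin n → ℂ}
    (hd : ∀ i, d i ^ m = 1) (he : ∀ i, e i ^ m = 1)
    (hreal : ∀ k, star (∑ i, d i ^ k - ∑ i, e i ^ k) = ∑ i, d i ^ k - ∑ i, e i ^ k) :
    ∃ c : ℤ, ∑ k ∈ Finset.range m, (∑ i, d i ^ k - ∑ i, e i ^ k) = m * c ∧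
      ∏ i, d i = (-1) ^ c * ∏ i, e i := by
  classical
  let S := Polynomial.nthRootsFinset m (1 : ℂ)
  have hS : ∀ z, z ∈ S ↔ z ^ m = 1 := fun z => Polynomial.mem_nthRootsFinset hm 1
  let nd : ℂ → ℕ := fun z => (Finset.univ.filter fun i => d i = z).card
  let ne : ℂ → ℕ := fun z => (Finset.univ.filter fun i => e i = z).card
  let c : ℂ → ℤ := fun z => nd z - ne z
  have hm0 : (m : ℂ) ≠ 0 := by exact_mod_cast hm.ne'
  have hc : ∀ z ∈ S, ∑ k ∈ Finset.range m, (∑ i, d i ^ k - ∑ i, e i ^ k) * z⁻¹ ^ k = m * c z := by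
    intro z hz
    simp_rw [sub_mul]
    rw [Finset.sum_sub_distrib, Complex.sum_range_powerSum hm hd ((hS z).1 hz),
      Complex.sum_range_powerSum hm he ((hS z).1 hz)]
    push_cast [c, nd, ne]
    ring
  have hinv : ∀ z ∈ S, z⁻¹ ∈ S := fun z hz => by
    rw [hS, inv_pow, (hS z).1 hz, inv_one]
  have hstar : ∀ z ∈ S, star z = z⁻¹ := fun z hz => by
    rw [Complex.inv_eq_conj (Complex.norm_eq_one_of_pow_eq_one ((hS z).1 hz) hm.ne')]
    rfl
  have h0 : ∀ z ∈ S, z ≠ 0 := by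
    rintro z hz rfl
    simp [hS, hm.ne'] at hz
  have hcinv : ∀ z ∈ S, c z⁻¹ = c z := by
    intro z hz
    have h1 := hc z hz
    have h2 := congrArg star (hc _ (hinv z hz))
    rw [star_sum] at h2
    simp_rw [star_mul', hreal, star_pow, star_inv₀, hstar z hz, inv_inv] at h2
    rw [h1] at h2
    have : (c z : ℂ) = c z⁻¹ := by
      have := mul_left_cancel₀ hm0 (h2.trans (by simp : _ = (m : ℂ) * c z⁻¹))
      exact this
    exact_mod_cast this.symm
  have hprod : ∀ (a : Fin n → ℂ), (∀ i, a i ^ m = 1) →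
      ∏ i, a i = ∏ z ∈ S, z ^ (Finset.univ.filter fun i => a i = z).card := by
    intro a ha
    rw [← Finset.prod_fiberwise_of_maps_to (t := S) (g := a) fun i _ => (hS _).2 (ha i)]
    refine Finset.prod_congr rfl fun z _ => ?_
    rw [Finset.prod_congr rfl (g := fun _ => z) fun i hi => (Finset.mem_filter.1 hi).2,
      Finset.prod_const]
  have hcard : ∀ (a : Fin n → ℂ), (∀ i, a i ^ m = 1) →
      n = ∑ z ∈ S, (Finset.univ.filter fun i => a i = z).card := by
    intro a ha
    have := Finset.card_eq_sum_card_fiberwise (s := Finset.univ) (t := S) (f := a)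
      fun i _ => (hS _).2 (ha i)
    simpa using this
  have h1S : (1 : ℂ) ∈ S := by simp [hS]
  have hsum : ∑ z ∈ S, c z = 0 := by
    have h1 := hcard d hd
    have h2 := hcard e he
    simp only [c, Finset.sum_sub_distrib, sub_eq_zero]
    exact_mod_cast h1.symm.trans h2
  have hinvol : ∏ z ∈ S.erase 1, (-z) ^ c z = 1 := by
    refine Finset.prod_involution (fun z _ => z⁻¹) ?_ ?_ ?_ ?_
    · intro z hz
      have hz := (Finset.mem_erase.1 hz).2
      rw [hcinv z hz, ← mul_zpow]
      simp [h0 z hz]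
    · intro z hz h heq
      obtain ⟨hz1, hz⟩ := Finset.mem_erase.1 hz
      rcases inv_eq_self₀.1 heq with h' | h' | h'
      · exact h (by simp [h'])
      · exact h0 z hz h'
      · exact hz1 h'
    · intro z hz
      obtain ⟨hz1, hz⟩ := Finset.mem_erase.1 hz
      exact Finset.mem_erase.2 ⟨by simpa using hz1, hinv z hz⟩
    · intro z _
      exact inv_inv z
  refine ⟨c 1, ?_, ?_⟩
  · simpa using hc 1 h1S
  · have hquot : ∏ z ∈ S, z ^ c z = (-1) ^ c 1 := by
      rw [← Finset.mul_prod_erase S _ h1S, one_zpow, one_mul]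
      have : ∏ z ∈ S.erase 1, z ^ c z = ∏ z ∈ S.erase 1, ((-1) ^ c z * (-z) ^ c z) :=
        Finset.prod_congr rfl fun z _ => by rw [← mul_zpow]; simp
      rw [this, Finset.prod_mul_distrib, hinvol, mul_one]
      rw [← Finset.add_sum_erase S _ h1S] at hsum
      have h3 : ∏ z ∈ S.erase 1, (-1 : ℂ) ^ c z = (-1) ^ ∑ z ∈ S.erase 1, c z := by
        induction S.erase 1 using Finset.induction_on with
        | empty => simp
        | insert a s ha ih =>
          rw [Finset.prod_insert ha, Finset.sum_insert ha, ih, zpow_add₀ (by simp)]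
      rw [h3, eq_neg_of_add_eq_zero_right hsum, zpow_neg, ← inv_zpow]
      simp
    rw [hprod d hd, hprod e he, ← hquot, ← Finset.prod_mul_distrib]
    refine Finset.prod_congr rfl fun z hz => ?_
    rw [← zpow_natCast, ← zpow_natCast, ← zpow_add₀ (h0 z hz)]
    simp [c, nd, ne]

namespace Chars

variable {G : Type} [Group G]

theorem exists_eigenvalues [Finite G] (V : FDRep ℂ G) (g : G) :
    ∃ (n : ℕ) (d : Fin n → ℂ), (∀ i, d i ^ orderOf g = 1) ∧ detChar V g = ∏ i, d i ∧
      ∀ k, V.character (g ^ k) = ∑ i, d i ^ k := by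
  obtain ⟨n, d, h1, h2, h3⟩ := Module.End.exists_eigenvalues_of_pow_eq_one (V.ρ g)
    (orderOf_pos g) (by rw [← map_pow, pow_orderOf_eq_one, map_one])
  refine ⟨n, d, h1, h2, fun k => ?_⟩
  rw [← h3 k, ← map_pow]
  rfl

theorem exists_sum_range_character [Finite G] (V : FDRep ℂ G) (g : G) :
    ∃ k : ℕ, ∑ i ∈ Finset.range (orderOf g), V.character (g ^ i) = orderOf g * k := by
  classical
  obtain ⟨n, d, h1, -, h3⟩ := exists_eigenvalues V g
  have := Complex.sum_range_powerSum (orderOf_pos g) h1 (one_pow _)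
  exact ⟨_, by simpa [h3] using this⟩

/-- The determinant of a real virtual character of degree zero. -/
theorem detChar_eq_of_real [Finite G] (V W : FDRep ℂ G) (g : G)
    (hdeg : V.character 1 = W.character 1)
    (hreal : ∀ x, star (V.character x - W.character x) = V.character x - W.character x) :
    ∃ c : ℤ, ∑ i ∈ Finset.range (orderOf g), (V.character - W.character) (g ^ i) =
      orderOf g * c ∧ detChar V g = (-1) ^ c * detChar W g := by
  obtain ⟨n, d, h1, h2, h3⟩ := exists_eigenvalues V g
  obtain ⟨n', e, h1', h2', h3'⟩ := exists_eigenvalues W g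
  obtain rfl : n = n' := by
    have a := h3 0
    have b := h3' 0
    rw [pow_zero, hdeg] at a
    rw [pow_zero, a] at b
    simpa using b
  obtain ⟨c, hc, hc'⟩ := Complex.prod_eq_of_powerSum_real (orderOf_pos g) h1 h1'
    fun k => by rw [← h3, ← h3', hreal]
  exact ⟨c, by simpa [h3, h3'] using hc, by rw [h2, h2', hc']⟩

theorem detChar_mul (V : FDRep ℂ G) (g h : G) :
    detChar V (g * h) = detChar V g * detChar V h := by
  simp [detChar]

theorem detChar_one (V : FDRep ℂ G) : detChar V 1 = 1 := by
  simp [detChar]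

theorem detChar_pow (V : FDRep ℂ G) (g : G) (n : ℕ) : detChar V (g ^ n) = detChar V g ^ n := by
  simp [detChar]

theorem detChar_ne_zero (V : FDRep ℂ G) (g : G) : detChar V g ≠ 0 := by
  intro h
  have := detChar_mul V g g⁻¹
  rw [h, zero_mul, mul_inv_cancel, detChar_one] at this
  exact one_ne_zero this

/-- The representation afforded by a homomorphism to matrices. -/
def matRep {n : ℕ} (M : G →* Matrix (Fin n) (Fin n) ℂ) : FDRep ℂ G :=
  FDRep.of (V := Fin n → ℂ)
    ((Matrix.toLinAlgEquiv' : Matrix (Fin n) (Fin n) ℂ ≃ₐ[ℂ] _).toMonoidHom.comp M)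

theorem matRep_character {n : ℕ} (M : G →* Matrix (Fin n) (Fin n) ℂ) (g : G) :
    (matRep M).character g = (M g).trace :=
  Matrix.trace_toLin'_eq (M g)

theorem detChar_matRep {n : ℕ} (M : G →* Matrix (Fin n) (Fin n) ℂ) (g : G) :
    detChar (matRep M) g = (M g).det :=
  LinearMap.det_toLin' (M g)

/-- The twist by a linear character of a representation, pulled back along a homomorphism. -/
def twist {G' : Type} [Group G'] (f : G' →* G) (ε : G' →* ℂ) (V : FDRep ℂ G) : FDRep ℂ G' :=
  FDRep.of (V := V)
    { toFun := fun g => ε g • V.ρ (f g)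
      map_one' := by simp
      map_mul' := fun g h => by simp [smul_smul, mul_comm] }

theorem twist_character {G' : Type} [Group G'] (f : G' →* G) (ε : G' →* ℂ) (V : FDRep ℂ G)
    (g : G') : (twist f ε V).character g = ε g * V.character (f g) :=
  (LinearMap.trace ℂ V).map_smul (ε g) (V.ρ (f g))

theorem detChar_twist_one {G' : Type} [Group G'] (f : G' →* G) (V : FDRep ℂ G)
    (g : G') : detChar (twist f 1 V) g = detChar V (f g) :=
  congrArg LinearMap.det (one_smul ℂ (V.ρ (f g)))

/-- The direct sum of two representations. -/
def directSum (V W : FDRep ℂ G) : FDRep ℂ G :=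
  FDRep.of (V := V × W)
    { toFun := fun g => (V.ρ g).prodMap (W.ρ g)
      map_one' := by ext <;> simp
      map_mul' := fun g h => by ext <;> simp }

theorem directSum_character (V W : FDRep ℂ G) (g : G) :
    (directSum V W).character g = V.character g + W.character g :=
  LinearMap.trace_prodMap' (V.ρ g) (W.ρ g)

end Chars

namespace Chars

open scoped Classical in
/-- The sum of a function over the conjugates of a group element, counted with multiplicity. -/
def conjSum {G : Type} [Group G] [Finite G] (f : G → ℂ) (g : G) : ℂ :=
  ∑ᶠ x : G, f (x⁻¹ * g * x)

open scoped Classical in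
/-- The indicator function of a subgroup. -/
def ind {G : Type} [Group G] (H : Subgroup G) (g : G) : ℂ := if g ∈ H then 1 else 0

variable {G : Type} [Group G] [Finite G]

theorem conjSum_apply [Fintype G] (f : G → ℂ) (g : G) :
    conjSum f g = ∑ x : G, f (x⁻¹ * g * x) :=
  finsum_eq_sum_of_fintype _

omit [Finite G] in
theorem ind_of_mem {H : Subgroup G} {g : G} (h : g ∈ H) : ind H g = 1 := if_pos h

omit [Finite G] in
theorem ind_of_notMem {H : Subgroup G} {g : G} (h : g ∉ H) : ind H g = 0 := if_neg h

omit [Finite G] in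
theorem star_ind (M : Subgroup G) : star (ind M) = ind M := by
  ext x
  by_cases hx : x ∈ M <;> simp [ind, hx]

theorem conjSum_add (f f' : G → ℂ) : conjSum (f + f') = conjSum f + conjSum f' := by
  have := Fintype.ofFinite G
  ext g
  simp [conjSum_apply, Finset.sum_add_distrib]

theorem conjSum_sub (f f' : G → ℂ) : conjSum (f - f') = conjSum f - conjSum f' := by
  have := Fintype.ofFinite G
  ext g
  simp [conjSum_apply, Finset.sum_sub_distrib]

theorem conjSum_smul (c : ℂ) (f : G → ℂ) : conjSum (c • f) = c • conjSum f := by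
  have := Fintype.ofFinite G
  ext g
  simp [conjSum_apply, Finset.mul_sum]

theorem conjSum_sum {ι : Type*} (s : Finset ι) (f : ι → G → ℂ) :
    conjSum (∑ i ∈ s, f i) = ∑ i ∈ s, conjSum (f i) := by
  have := Fintype.ofFinite G
  ext g
  simp only [conjSum_apply, Finset.sum_apply]
  rw [Finset.sum_comm]

theorem conjSum_star (f : G → ℂ) : conjSum (star f) = star (conjSum f) := by
  have := Fintype.ofFinite G
  ext g
  simp [conjSum_apply]

theorem conjSum_conj (f : G → ℂ) (a : G) :
    conjSum (fun x => f (a⁻¹ * x * a)) = conjSum f := by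
  have := Fintype.ofFinite G
  ext g
  rw [conjSum_apply, conjSum_apply]
  refine Fintype.sum_equiv (Equiv.mulRight a) _ _ fun x => ?_
  simp [mul_assoc]

theorem conjSum_mul_class (f ε : G → ℂ) (hε : ∀ x g, ε (x⁻¹ * g * x) = ε g) :
    conjSum (ε * f) = ε * conjSum f := by
  have := Fintype.ofFinite G
  ext g
  simp [conjSum_apply, Finset.mul_sum, hε]

omit [Finite G] in
/-- A sum over a group of a function that is constant on cosets. -/
theorem sum_eq_card_mul_sum_out {M : Type*} [AddCommMonoid M] [Fintype G] (H : Subgroup G)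
    [Fintype (G ⧸ H)] (f : G → M) (hf : ∀ g, ∀ h ∈ H, f (g * h) = f g) :
    ∑ g : G, f g = Nat.card H • ∑ x : G ⧸ H, f x.out := by
  have := Fintype.ofFinite H
  have hbij : Function.Bijective fun y : (G ⧸ H) × H => y.1.out * (y.2 : G) := by
    constructor
    · rintro ⟨x, h⟩ ⟨y, k⟩ hxy
      have hx : x = y := by
        have := congrArg (QuotientGroup.mk : G → G ⧸ H) hxy
        simpa [QuotientGroup.mk_mul_of_mem, h.2, k.2] using this
      subst hx
      simpa using hxy
    · intro g
      refine ⟨(QuotientGroup.mk g, ⟨(QuotientGroup.mk g : G ⧸ H).out⁻¹ * g, ?_⟩), by simp⟩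
      rw [← QuotientGroup.eq]
      exact QuotientGroup.out_eq' _
  rw [← Fintype.sum_bijective _ hbij (fun y => f (y.1.out * (y.2 : G))) _ fun _ => rfl,
    Fintype.sum_prod_type, Finset.smul_sum]
  refine Finset.sum_congr rfl fun x _ => ?_
  have : ∀ y : H, f (x.out * y) = f x.out := fun y => hf _ _ y.2
  simp [this, Nat.card_eq_fintype_card]

theorem permChar_eq (H : Subgroup G) :
    permChar H = (Nat.card H : ℂ)⁻¹ • conjSum (ind H) := by
  classical
  have := Fintype.ofFinite G
  have := Fintype.ofFinite (G ⧸ H)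
  ext g
  have hH : (Nat.card H : ℂ) ≠ 0 := by exact_mod_cast Nat.card_pos.ne'
  rw [Pi.smul_apply, smul_eq_mul, conjSum_apply, sum_eq_card_mul_sum_out H, nsmul_eq_mul,
    inv_mul_cancel_left₀ hH, permChar]
  · have : ∀ x : G ⧸ H, ind H (x.out⁻¹ * g * x.out) = if g • x = x then 1 else 0 := by
      intro x
      have : g • x = x ↔ x.out⁻¹ * g * x.out ∈ H := by
        conv_lhs => rw [← QuotientGroup.out_eq' x]
        rw [← QuotientGroup.mk_mul_of_mem _ (one_mem H), mul_one, eq_comm]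
        rw [MulAction.Quotient.smul_mk, QuotientGroup.eq, smul_eq_mul, mul_assoc]
      simp [ind, this]
    simp_rw [this]
    rw [Finset.sum_boole, Nat.card_eq_fintype_card, Fintype.card_subtype]
  · intro x h hh
    have : (x * h)⁻¹ * g * (x * h) ∈ H ↔ x⁻¹ * g * x ∈ H := by
      have : (x * h)⁻¹ * g * (x * h) = h⁻¹ * (x⁻¹ * g * x * h) := by group
      rw [this, H.mul_mem_cancel_left (inv_mem hh), H.mul_mem_cancel_right hh]
    simp only [ind, this]

omit [Finite G] in
theorem permChar_one (H : Subgroup G) : permChar H 1 = H.index := by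
  simp [permChar, Subgroup.index]

theorem indChar_eq (H : Subgroup G) (f : H → ℂ) (F : G → ℂ)
    (hF : ∀ h : H, F h = f h) (hF' : ∀ g ∉ H, F g = 0) :
    indChar H f = (Nat.card H : ℂ)⁻¹ • conjSum F := by
  ext g
  rw [indChar, Pi.smul_apply, smul_eq_mul, conjSum]
  congr 2
  ext x
  split_ifs with h
  · exact (hF ⟨_, h⟩).symm
  · exact (hF' _ h).symm

/-- The representation induced from a linear character `ψ` of `J`, extended by zero. -/
theorem exists_induced (J : Subgroup G) (ψ : G → ℂ) (h1 : ψ 1 = 1) (h0 : ∀ g ∉ J, ψ g = 0)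
    (hmul : ∀ x ∈ J, ∀ y ∈ J, ψ (x * y) = ψ x * ψ y) :
    ∃ V : FDRep ℂ G, V.character = (Nat.card J : ℂ)⁻¹ • conjSum ψ := by
  classical
  have := Fintype.ofFinite G
  have := Fintype.ofFinite (G ⧸ J)
  have hJ : (Nat.card J : ℂ) ≠ 0 := by exact_mod_cast Nat.card_pos.ne'
  have hmul' : ∀ x y, x ∈ J ∨ y ∈ J → ψ (x * y) = ψ x * ψ y := by
    intro x y h
    by_cases hx : x ∈ J <;> by_cases hy : y ∈ J
    · exact hmul x hx y hy
    · rw [h0 y hy, mul_zero, h0]; rwa [J.mul_mem_cancel_left hx]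
    · rw [h0 x hx, zero_mul, h0]; rwa [J.mul_mem_cancel_right hy]
    · tauto
  let A : G → Matrix (G ⧸ J) (G ⧸ J) ℂ := fun g => Matrix.of fun x y => ψ (x.out⁻¹ * g * y.out)
  have hA1 : A 1 = 1 := by
    ext x y
    change ψ (x.out⁻¹ * 1 * y.out) = _
    rw [mul_one, Matrix.one_apply]
    split_ifs with h
    · simp [h, h1]
    · refine h0 _ fun hx => h ?_
      rw [← QuotientGroup.out_eq' x, ← QuotientGroup.out_eq' y]
      exact QuotientGroup.eq.2 hx
  have hAmul : ∀ g h, A (g * h) = A g * A h := by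
    intro g h
    ext x z
    rw [Matrix.mul_apply, Finset.sum_eq_single (QuotientGroup.mk (h * z.out))]
    · have hz : (QuotientGroup.mk (h * z.out) : G ⧸ J).out⁻¹ * h * z.out ∈ J := by
        rw [mul_assoc, ← QuotientGroup.eq]
        exact QuotientGroup.out_eq' _
      simp only [A, Matrix.of_apply]
      rw [← hmul' _ _ (Or.inr hz)]
      simp [mul_assoc]
    · intro y _ hy
      simp only [A, Matrix.of_apply]
      rw [h0 (y.out⁻¹ * h * z.out), mul_zero]
      intro hy'
      rw [mul_assoc, ← QuotientGroup.eq] at hy'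
      exact hy ((QuotientGroup.out_eq' y).symm.trans hy')
    · simp
  let e := Fintype.equivFin (G ⧸ J)
  let M : G →* Matrix (Fin _) (Fin _) ℂ :=
    { toFun := fun g => Matrix.reindexAlgEquiv ℂ ℂ e (A g)
      map_one' := by rw [hA1, map_one]
      map_mul' := fun g h => by rw [hAmul, map_mul] }
  refine ⟨matRep M, ?_⟩
  ext g
  rw [matRep_character, Pi.smul_apply, smul_eq_mul, conjSum_apply, sum_eq_card_mul_sum_out J,
    nsmul_eq_mul, inv_mul_cancel_left₀ hJ]
  · change ∑ i, A g (e.symm i) (e.symm i) = _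
    rw [e.symm.sum_comp fun x => A g x x]
    rfl
  · intro x j hj
    rw [mul_inv_rev, mul_assoc, mul_assoc, hmul' _ _ (Or.inl (inv_mem hj)), ← mul_assoc,
      ← mul_assoc, hmul' _ _ (Or.inr hj), mul_left_comm, ← hmul' _ _ (Or.inl (inv_mem hj))]
    simp [h1]

theorem exists_permRep (H : Subgroup G) : ∃ V : FDRep ℂ G, V.character = permChar H := by
  rw [permChar_eq]
  refine exists_induced H _ (ind_of_mem (one_mem H)) (fun g => ind_of_notMem) fun x hx y hy => ?_
  rw [ind_of_mem hx, ind_of_mem hy, ind_of_mem (mul_mem hx hy), mul_one]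

/-- `Ind_J^G (ψ + ψ̄ - 2)` as the sum of a virtual character of degree zero and its conjugate. -/
theorem exists_selfConj (J : Subgroup G) (ψ : G → ℂ) (h1 : ψ 1 = 1) (h0 : ∀ g ∉ J, ψ g = 0)
    (hmul : ∀ x ∈ J, ∀ y ∈ J, ψ (x * y) = ψ x * ψ y) :
    ∃ V W : FDRep ℂ G, V.character 1 = W.character 1 ∧
      (Nat.card J : ℂ)⁻¹ • conjSum (ψ + star ψ - (2 : ℂ) • ind J) =
        (V.character - W.character) + star (V.character - W.character) := by
  obtain ⟨V, hV⟩ := exists_induced J ψ h1 h0 hmul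
  obtain ⟨W, hW⟩ := exists_permRep J
  rw [permChar_eq] at hW
  refine ⟨V, W, ?_, ?_⟩
  · have := Fintype.ofFinite G
    rw [hV, hW]
    simp only [Pi.smul_apply, conjSum_apply, mul_one, inv_mul_cancel, h1, ind_of_mem (one_mem J)]
  · have : ψ + star ψ - (2 : ℂ) • ind J = (ψ - ind J) + star (ψ - ind J) := by
      rw [star_sub, star_ind, two_smul]
      abel
    rw [this, conjSum_add, conjSum_star, hV, hW, ← smul_sub, ← conjSum_sub, star_smul, smul_add]
    simp

end Chars

namespace Chars

variable {G : Type} [Group G]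

/-- The group of permutation characters. -/
def permGroup (G : Type) [Group G] : AddSubgroup (G → ℂ) :=
  AddSubgroup.closure (Set.range permChar)

theorem permChar_mem (H : Subgroup G) : permChar H ∈ permGroup G :=
  AddSubgroup.subset_closure ⟨H, rfl⟩

theorem permGroup_le {A : AddSubgroup (G → ℂ)} (h : ∀ H : Subgroup G, permChar H ∈ A) :
    permGroup G ≤ A :=
  (AddSubgroup.closure_le A).2 (Set.range_subset_iff.2 h)

theorem isPermChar_iff [Finite G] (χ : G → ℂ) : IsPermChar χ ↔ χ ∈ permGroup G := by
  constructor
  · rintro ⟨k, Hs, ns, rfl⟩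
    have : (fun g => ∑ i, (ns i : ℂ) * permChar (Hs i) g) = ∑ i, ns i • permChar (Hs i) := by
      ext g
      simp
    rw [this]
    exact sum_mem fun i _ => zsmul_mem (permChar_mem _) _
  · intro h
    have := Fintype.ofFinite (Subgroup G)
    have h' : χ ∈ Submodule.span ℤ (Set.range (permChar (G := G))) := by
      rw [← AddSubgroup.toIntSubmodule_closure]
      exact h
    obtain ⟨c, rfl⟩ := (Submodule.mem_span_range_iff_exists_fun ℤ).1 h'
    let e := Fintype.equivFin (Subgroup G)
    refine ⟨_, e.symm, c ∘ e.symm, ?_⟩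
    ext g
    have := e.symm.sum_comp fun H => (c H : ℂ) * permChar H g
    simpa using this.symm

theorem permGroup_star {χ : G → ℂ} (h : χ ∈ permGroup G) : star χ = χ := by
  have : permGroup G ≤ (starAddEquiv.toAddMonoidHom : (G → ℂ) →+ (G → ℂ)).eqLocus
      (AddMonoidHom.id _) :=
    permGroup_le fun H => by
      ext g
      simp [permChar]
  exact this h

theorem permGroup_one {χ : G → ℂ} (h : χ ∈ permGroup G) : ∃ n : ℤ, χ 1 = n := by
  have : permGroup G ≤ (AddSubgroup.comap (Pi.evalAddMonoidHom (fun _ : G => ℂ) 1)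
      (Int.castAddHom ℂ).range) :=
    permGroup_le fun H => ⟨H.index, by simp [permChar_one]⟩
  obtain ⟨n, hn⟩ := this h
  exact ⟨n, hn.symm⟩

/-- The group of virtual characters. -/
def virtualGroup (G : Type) [Group G] [Finite G] : AddSubgroup (G → ℂ) where
  carrier := {χ | IsVirtualChar χ}
  zero_mem' := ⟨_, _, (sub_self (exists_permRep (⊤ : Subgroup G)).choose.character).symm⟩
  add_mem' := by
    rintro _ _ ⟨V, W, rfl⟩ ⟨V', W', rfl⟩
    refine ⟨directSum V V', directSum W W', ?_⟩
    ext g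
    simp only [Pi.add_apply, Pi.sub_apply, directSum_character]
    ring
  neg_mem' := by
    rintro _ ⟨V, W, rfl⟩
    exact ⟨W, V, neg_sub _ _⟩

theorem isVirtualChar_of_mem_permGroup [Finite G] {χ : G → ℂ} (h : χ ∈ permGroup G) :
    IsVirtualChar χ := by
  refine permGroup_le (A := virtualGroup G) (fun H => ?_) h
  have h1 := (virtualGroup G).zero_mem
  obtain ⟨V, hV⟩ := exists_permRep H
  obtain ⟨W, W', hW⟩ := h1
  refine ⟨directSum V W, W', ?_⟩
  ext g
  have := congrFun hW g
  simp only [Pi.zero_apply, Pi.sub_apply] at this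
  rw [Pi.sub_apply, directSum_character, ← hV, add_sub_assoc, ← this, add_zero]

/-- Functions whose restriction to `⟨g⟩` contains the trivial character an even number of times. -/
def evenAt (g : G) : AddSubgroup (G → ℂ) where
  carrier := {χ | ∃ z : ℤ, ∑ i ∈ Finset.range (orderOf g), χ (g ^ i) = orderOf g * (2 * z)}
  zero_mem' := ⟨0, by simp⟩
  add_mem' := by
    rintro χ ψ ⟨a, ha⟩ ⟨b, hb⟩
    refine ⟨a + b, ?_⟩
    simp only [Pi.add_apply, Finset.sum_add_distrib, ha, hb]
    push_cast
    ring
  neg_mem' := by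
    rintro χ ⟨a, ha⟩
    exact ⟨-a, by simp [ha]⟩

theorem mem_evenAt_of_hasTrivialDet [Finite G] {χ : G → ℂ} (hdet : HasTrivialDet χ)
    (hone : χ 1 = 0) (hreal : star χ = χ) (g : G) : χ ∈ evenAt g := by
  obtain ⟨V, W, rfl, hVW⟩ := hdet
  obtain ⟨c, hc, hc'⟩ := detChar_eq_of_real V W g (sub_eq_zero.1 hone) (congrFun hreal)
  have h1 : (-1 : ℂ) ^ c = 1 :=
    mul_right_cancel₀ (detChar_ne_zero W g) (by rw [← hc', one_mul, hVW])
  obtain ⟨z, rfl⟩ : Even c := by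
    by_contra hodd
    rw [Int.not_even_iff_odd] at hodd
    rw [hodd.neg_one_zpow] at h1
    norm_num at h1
  exact ⟨z, by rw [hc]; push_cast; ring⟩

/-- A permutation character of degree zero has trivial determinant if it contains the trivial
character evenly often on every cyclic subgroup of order a power of two. -/
theorem hasTrivialDet_of_evenAt [Finite G] {χ : G → ℂ} (hχ : χ ∈ permGroup G)
    (hone : χ 1 = 0) (h : ∀ (g : G) (k : ℕ), g ^ 2 ^ k = 1 → χ ∈ evenAt g) :
    HasTrivialDet χ := by
  have hreal := permGroup_star hχ
  obtain ⟨V, W, rfl⟩ := isVirtualChar_of_mem_permGroup hχ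
  refine ⟨V, W, rfl, fun g => ?_⟩
  obtain ⟨k, m, hm, hkm⟩ := Nat.exists_eq_two_pow_mul_odd (orderOf_pos g).ne'
  have hy : (g ^ m) ^ 2 ^ k = 1 := by
    rw [← pow_mul, mul_comm, ← hkm, pow_orderOf_eq_one]
  obtain ⟨c, hc, hc'⟩ := detChar_eq_of_real V W (g ^ m) (sub_eq_zero.1 hone) (congrFun hreal)
  obtain ⟨z, hz⟩ := h _ k hy
  obtain ⟨d, -, hd⟩ := detChar_eq_of_real V W g (sub_eq_zero.1 hone) (congrFun hreal)
  have hcz : c = 2 * z := by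
    have := mul_left_cancel₀ (by exact_mod_cast (orderOf_pos (g ^ m)).ne') (hc.symm.trans hz)
    exact_mod_cast this
  rw [hcz, (even_two_mul z).neg_one_zpow, one_mul, detChar_pow, detChar_pow, hd, mul_pow] at hc'
  have h1 : ((-1 : ℂ) ^ d) ^ m = 1 :=
    mul_right_cancel₀ (pow_ne_zero m (detChar_ne_zero W g)) (by rw [hc', one_mul])
  rw [hd]
  rcases Int.even_or_odd d with he | ho
  · rw [he.neg_one_zpow, one_mul]
  · rw [ho.neg_one_zpow, hm.neg_one_pow] at h1
    norm_num at h1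

/-- `P_G` as an additive group. -/
def memPGroup (G : Type) [Group G] [Finite G] : AddSubgroup (G → ℂ) where
  carrier := {χ | MemP G χ}
  zero_mem' := .zero
  add_mem' := .add
  neg_mem' := fun {χ} h => by
    have := MemP.zsmul (-1) h
    rwa [neg_one_zsmul] at this

theorem mem_memPGroup [Finite G] {χ : G → ℂ} : χ ∈ memPGroup G ↔ MemP G χ := Iff.rfl

theorem selfConj_mem_evenAt [Finite G] (V W : FDRep ℂ G) (g : G) :
    (V.character - W.character) + star (V.character - W.character) ∈ evenAt g := by
  obtain ⟨a, ha⟩ := exists_sum_range_character V g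
  obtain ⟨b, hb⟩ := exists_sum_range_character W g
  refine ⟨a - b, ?_⟩
  simp only [Pi.add_apply, Pi.sub_apply, Pi.star_apply, Finset.sum_add_distrib,
    Finset.sum_sub_distrib, ← star_sum, ha, hb]
  simp
  ring

section Inflation

variable [Finite G] (N : Subgroup G) [N.Normal]

theorem conjSum_comp_mk (F : G ⧸ N → ℂ) :
    conjSum (fun g : G => F g) = fun g : G => (Nat.card N : ℂ) * conjSum F g := by
  have := Fintype.ofFinite G
  have := Fintype.ofFinite (G ⧸ N)
  ext g
  rw [conjSum_apply, sum_eq_card_mul_sum_out N, conjSum_apply, nsmul_eq_mul]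
  · simp
  · intro x n hn
    simp [QuotientGroup.mk_mul_of_mem _ hn, (QuotientGroup.eq_one_iff n).2 hn]

theorem card_comap_mk (H : Subgroup (G ⧸ N)) :
    Nat.card (H.comap (QuotientGroup.mk' N)) = Nat.card N * Nat.card H := by
  have h1 := (H.comap (QuotientGroup.mk' N)).card_mul_index
  have h2 := H.card_mul_index
  have h3 := N.card_mul_index
  rw [H.index_comap_of_surjective (QuotientGroup.mk'_surjective N)] at h1
  have h4 : N.index = Nat.card (G ⧸ N) := rfl
  have h5 : 0 < H.index := Nat.pos_of_ne_zero H.index_ne_zero_of_finite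
  refine Nat.eq_of_mul_eq_mul_right h5 ?_
  rw [h1, ← h3, h4, ← h2, mul_assoc]

theorem inv_card_smul_conjSum_comp_mk (H : Subgroup (G ⧸ N)) (F : G ⧸ N → ℂ) :
    (Nat.card (H.comap (QuotientGroup.mk' N)) : ℂ)⁻¹ • conjSum (fun g : G => F g) =
      fun g : G => ((Nat.card H : ℂ)⁻¹ • conjSum F) g := by
  ext g
  have : (Nat.card N : ℂ) ≠ 0 := by exact_mod_cast Nat.card_pos.ne'
  rw [conjSum_comp_mk, card_comap_mk]
  simp only [Pi.smul_apply, smul_eq_mul, Nat.cast_mul, mul_inv]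
  field_simp

theorem permChar_comap_mk (H : Subgroup (G ⧸ N)) :
    permChar (H.comap (QuotientGroup.mk' N)) = fun g : G => permChar H g := by
  rw [permChar_eq, permChar_eq, ← inv_card_smul_conjSum_comp_mk]
  rfl

theorem permChar_eq_comp_mk {H : Subgroup G} (h : N ≤ H) :
    permChar H = fun g : G => permChar (H.map (QuotientGroup.mk' N)) g := by
  rw [← permChar_comap_mk, Subgroup.comap_map_eq_self (by rwa [QuotientGroup.ker_mk'])]

theorem memP_comp_mk {χ : G ⧸ N → ℂ} (h : MemP (G ⧸ N) χ) : MemP G fun g : G => χ g := by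
  classical
  induction h with
  | zero => exact .zero
  | add _ _ h1 h2 => exact .add h1 h2
  | zsmul n _ h => exact .zsmul n h
  | selfConj V W hdeg =>
    have h := MemP.selfConj (twist (QuotientGroup.mk' N) 1 V) (twist (QuotientGroup.mk' N) 1 W)
      (by simp only [twist_character, map_one, hdeg])
    convert h using 1
    ext g
    simp [twist_character]
  | dihedralInd H τ hdeg K hfac hquot =>
    let π : H.comap (QuotientGroup.mk' N) →* H :=
      (QuotientGroup.mk' N).subgroupComap H
    have hπ : Function.Surjective π :=
      (QuotientGroup.mk' N).subgroupComap_surjective_of_surjective H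
        (QuotientGroup.mk'_surjective N)
    let φ := (QuotientGroup.mk' K).comp π
    have hφ : Function.Surjective φ := (QuotientGroup.mk'_surjective K).comp hπ
    have e := QuotientGroup.quotientKerEquivOfSurjective φ hφ
    have h := MemP.dihedralInd (G := G) (H.comap (QuotientGroup.mk' N)) (twist π 1 τ)
      (by rw [twist_character, map_one, map_one, one_mul, hdeg]) φ.ker
      (by
        intro n h hn
        have hn' : π n ∈ K := by
          rwa [MonoidHom.mem_ker, MonoidHom.comp_apply, QuotientGroup.mk'_apply,
            QuotientGroup.eq_one_iff] at hn
        simp [twist_character, hfac _ _ hn'])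
      (by
        rcases hquot with ⟨⟨f⟩⟩ | ⟨⟨f⟩⟩ | ⟨p, h1, h2, ⟨f⟩⟩
        · exact Or.inl ⟨e.trans f⟩
        · exact Or.inr (Or.inl ⟨e.trans f⟩)
        · exact Or.inr (Or.inr ⟨p, h1, h2, ⟨e.trans f⟩⟩))
    let F : G ⧸ N → ℂ := fun g => if hg : g ∈ H then (τ.character - 1 - detChar τ) ⟨g, hg⟩ else 0
    convert h using 1
    rw [indChar_eq H _ F (fun h => dif_pos h.2) (fun g hg => dif_neg hg),
      indChar_eq _ _ (fun g : G => F g), inv_card_smul_conjSum_comp_mk]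
    · intro h
      have hh : ((h : G) : G ⧸ N) ∈ H := h.2
      simp only [F, dif_pos hh, Pi.sub_apply, Pi.one_apply, detChar_twist_one, twist_character,
        MonoidHom.one_apply, one_mul]
      rfl
    · intro g hg
      exact dif_neg hg

/-- `S_{G/N} ⊆ P_{G/N}` in the presence of a function on `G` agreeing with an element of `S_G`. -/
theorem memP_of_evenAt (hquot : ∀ χ : G ⧸ N → ℂ, MemS χ → MemP (G ⧸ N) χ) {h : G ⧸ N → ℂ}
    (hperm : h ∈ permGroup (G ⧸ N)) (hone : h 1 = 0)
    (heven : ∀ (x : G ⧸ N) (k : ℕ), x ^ 2 ^ k = 1 → h ∈ evenAt x) :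
    MemP G fun g : G => h g :=
  memP_comp_mk N (hquot _ ⟨(isPermChar_iff _).2 hperm, hone,
    hasTrivialDet_of_evenAt hperm hone heven⟩)

theorem exists_lift_pow_two_pow (x : G ⧸ N) (k : ℕ) (hx : x ^ 2 ^ k = 1) :
    ∃ (g : G) (l : ℕ), g ^ 2 ^ l = 1 ∧ (g : G ⧸ N) = x := by
  obtain ⟨y, rfl⟩ := QuotientGroup.mk_surjective x
  obtain ⟨l, m, hm, hlm⟩ := Nat.exists_eq_two_pow_mul_odd (orderOf_pos y).ne'
  have hcop : Nat.Coprime m (2 ^ k) := Nat.Coprime.pow_right k hm.coprime_two_right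
  obtain ⟨b, hb⟩ := Nat.exists_mul_mod_eq_of_coprime 1 hcop (by positivity)
  refine ⟨y ^ (m * b), l, ?_, ?_⟩
  · rw [← pow_mul, mul_right_comm, mul_comm m, ← hlm, pow_mul, pow_orderOf_eq_one, one_pow]
  · rw [QuotientGroup.mk_pow]
    have h1 : m * b ≡ 1 [MOD 2 ^ k] := hb.2
    have h2 := h1.of_dvd (orderOf_dvd_of_pow_eq_one hx)
    rw [pow_eq_pow_iff_modEq.2 h2, pow_one]

theorem mem_evenAt_comp_mk {h : G ⧸ N → ℂ} {g : G}
    (heven : (fun x : G => h x) ∈ evenAt g) : h ∈ evenAt (g : G ⧸ N) := by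
  obtain ⟨z, hz⟩ := heven
  have hd := orderOf_map_dvd (QuotientGroup.mk' N) g
  obtain ⟨c, hc⟩ := hd
  rw [QuotientGroup.mk'_apply] at hc
  refine ⟨z, ?_⟩
  have hsum : ∑ i ∈ Finset.range (orderOf g), h ((g ^ i : G) : G ⧸ N) =
      c * ∑ i ∈ Finset.range (orderOf (g : G ⧸ N)), h ((g : G ⧸ N) ^ i) := by
    rw [hc]
    clear hc hz
    induction c with
    | zero => simp
    | succ c ih =>
      rw [mul_add_one, Finset.sum_range_add, ih]
      push_cast
      rw [add_one_mul]
      congr 1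
      refine Finset.sum_congr rfl fun i _ => ?_
      rw [QuotientGroup.mk_pow, pow_add, pow_mul, pow_orderOf_eq_one, one_pow, one_mul]
  rw [hsum, hc] at hz
  have hc0 : (c : ℂ) ≠ 0 := by
    rintro h0
    rw [Nat.cast_eq_zero] at h0
    rw [h0, mul_zero] at hc
    exact (orderOf_pos g).ne' hc
  refine mul_left_cancel₀ hc0 ?_
  rw [hz]
  push_cast
  ring

/-- An element of `S_G` lies in `P_G` if modulo `P_G` it is inflated from `G/N` by a
permutation character with the same values on elements of order a power of two. -/
theorem memP_of_eq_on_two_elements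
    (hquot : ∀ χ : G ⧸ N → ℂ, MemS χ → MemP (G ⧸ N) χ) {χ : G → ℂ} (hχ : MemS χ) {h : G ⧸ N → ℂ}
    (hperm : h ∈ permGroup (G ⧸ N)) (hP : (χ - fun g : G => h g) ∈ memPGroup G)
    (heq : ∀ (g : G) (k : ℕ), g ^ 2 ^ k = 1 → χ g = h g) : MemP G χ := by
  obtain ⟨hχ1, hχ2, hχ3⟩ := hχ
  rw [isPermChar_iff] at hχ1
  have h1 : MemP G fun g : G => h g := by
    refine memP_of_evenAt N hquot hperm ?_ fun x k hx => ?_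
    · rw [← hχ2, heq 1 0 (one_pow _), QuotientGroup.mk_one]
    · obtain ⟨g, l, hg, rfl⟩ := exists_lift_pow_two_pow N x k hx
      refine mem_evenAt_comp_mk N ?_
      obtain ⟨z, hz⟩ := mem_evenAt_of_hasTrivialDet hχ3 hχ2 (permGroup_star hχ1) g
      refine ⟨z, hz ▸ Finset.sum_congr rfl fun i _ => (heq _ l ?_).symm⟩
      rw [← pow_mul, mul_comm, pow_mul, hg, one_pow]
  have := add_mem hP (mem_memPGroup.2 h1)
  rwa [sub_add_cancel] at this

end Inflation

end Chars

namespace Chars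

variable {G : Type} [Group G]

theorem card_eq_card_map_mul_card_inf_ker {A : Type*} [Group A] (α : G →* A) (S : Subgroup G) :
    Nat.card S = Nat.card (S.map α) * Nat.card (S ⊓ α.ker : Subgroup G) := by
  let f := α.comp S.subtype
  have h1 := f.ker.card_mul_index
  rw [Subgroup.index_ker, MonoidHom.range_comp, Subgroup.range_subtype] at h1
  have h2 : Nat.card f.ker = Nat.card (S ⊓ α.ker : Subgroup G) := by
    rw [← Subgroup.card_map_of_injective S.subtype_injective (K := f.ker), inf_comm,
      ← Subgroup.subgroupOf_map_subtype]
    rfl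
  rw [← h1, h2, mul_comm]

/-- The functions on `G` that make `J` act on the cosets of `H` through the affine group of
`ZMod p`, with linear part `α`. -/
structure AffineStep {p : ℕ} (α : G →* (ZMod p)ˣ) (H J : Subgroup G) (E : G → ZMod p) : Prop where
  le : H ≤ J
  map_mul : ∀ x ∈ J ⊓ α.ker, ∀ y ∈ J ⊓ α.ker, E (x * y) = E x + E y
  map_conj : ∀ j ∈ J, ∀ x ∈ J ⊓ α.ker, E (j * x * j⁻¹) = α j * E x
  eq_zero_iff : ∀ x ∈ J ⊓ α.ker, E x = 0 ↔ x ∈ H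
  exists_one : ∃ x ∈ J ⊓ α.ker, E x = 1
  exists_mul : ∀ j ∈ J, ∃ m ∈ J ⊓ α.ker, ∃ h ∈ H, j = m * h

namespace AffineStep

variable {p : ℕ} {α : G →* (ZMod p)ˣ} {H J : Subgroup G} {E : G → ZMod p}

theorem map_one (hE : AffineStep α H J E) : E 1 = 0 :=
  (hE.eq_zero_iff 1 (one_mem _)).2 (one_mem _)

theorem map_inv (hE : AffineStep α H J E) {x : G} (hx : x ∈ J ⊓ α.ker) : E x⁻¹ = -E x := by
  have := hE.map_mul x⁻¹ (inv_mem hx) x hx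
  rw [inv_mul_cancel, hE.map_one] at this
  exact eq_neg_of_add_eq_zero_left this.symm

theorem map_pow (hE : AffineStep α H J E) {x : G} (hx : x ∈ J ⊓ α.ker) (n : ℕ) :
    E (x ^ n) = n * E x := by
  induction n with
  | zero => simp [hE.map_one]
  | succ n ih => rw [pow_succ, hE.map_mul _ (pow_mem hx n) _ hx, ih]; push_cast; ring

theorem conj_mem {j x : G} (hj : j ∈ J) (hx : x ∈ J ⊓ α.ker) : j * x * j⁻¹ ∈ J ⊓ α.ker :=
  ⟨J.mul_mem (J.mul_mem hj hx.1) (J.inv_mem hj), α.normal_ker.conj_mem x hx.2 j⟩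

theorem exists_eq [NeZero p] (hE : AffineStep α H J E) (t : ZMod p) :
    ∃ x ∈ J ⊓ α.ker, E x = t := by
  obtain ⟨x, hx, hx1⟩ := hE.exists_one
  exact ⟨x ^ t.val, pow_mem hx _, by rw [hE.map_pow hx, hx1]; simp⟩

theorem map_eq (hE : AffineStep α H J E) : H.map α = J.map α := by
  refine le_antisymm (Subgroup.map_mono hE.le) ?_
  rintro _ ⟨j, hj, rfl⟩
  obtain ⟨m, hm, h, hh, rfl⟩ := hE.exists_mul j hj
  refine ⟨h, hh, ?_⟩
  rw [_root_.map_mul, MonoidHom.mem_ker.1 hm.2, one_mul]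

open scoped Classical in
theorem card_fiber [Fintype G] [NeZero p] (hE : AffineStep α H J E) (t : ZMod p) :
    (Finset.univ.filter fun m => m ∈ J ⊓ α.ker ∧ E m = t).card =
      Nat.card (H ⊓ α.ker : Subgroup G) := by
  obtain ⟨x, hx, rfl⟩ := hE.exists_eq t
  have hK : Nat.card (H ⊓ α.ker : Subgroup G) =
      (Finset.univ.filter fun k => k ∈ H ⊓ α.ker).card := by
    rw [Nat.card_eq_fintype_card, Fintype.card_subtype]
  rw [hK]
  refine (Finset.card_bij (fun k _ => x * k) ?_ ?_ ?_).symm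
  · intro k hk
    rw [Finset.mem_filter] at hk ⊢
    have hkM : k ∈ J ⊓ α.ker := ⟨hE.le hk.2.1, hk.2.2⟩
    refine ⟨Finset.mem_univ _, mul_mem hx hkM, ?_⟩
    rw [hE.map_mul _ hx _ hkM, (hE.eq_zero_iff k hkM).2 hk.2.1, add_zero]
  · intro a _ b _ hab
    exact mul_left_cancel hab
  · intro m hm
    rw [Finset.mem_filter] at hm
    have hM : x⁻¹ * m ∈ J ⊓ α.ker := mul_mem (inv_mem hx) hm.2.1
    refine ⟨x⁻¹ * m, ?_, by simp⟩
    rw [Finset.mem_filter]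
    refine ⟨Finset.mem_univ _, (hE.eq_zero_iff _ hM).1 ?_, hM.2⟩
    rw [hE.map_mul _ (inv_mem hx) _ hm.2.1, hE.map_inv hx, hm.2.2, neg_add_cancel]

theorem card_ker [Finite G] [NeZero p] (hE : AffineStep α H J E) :
    Nat.card (J ⊓ α.ker : Subgroup G) = p * Nat.card (H ⊓ α.ker : Subgroup G) := by
  classical
  have := Fintype.ofFinite G
  have hM : Nat.card (J ⊓ α.ker : Subgroup G) =
      (Finset.univ.filter fun k => k ∈ J ⊓ α.ker).card := by
    rw [Nat.card_eq_fintype_card, Fintype.card_subtype]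
  rw [hM, Finset.card_eq_sum_card_fiberwise (f := E) (t := Finset.univ) fun _ _ => Finset.mem_univ _]
  simp_rw [Finset.filter_filter, hE.card_fiber]
  simp [ZMod.card]

open scoped Classical in
theorem card_conj_mem [Fintype G] [Fact p.Prime] (hE : AffineStep α H J E) {j : G} (hj : j ∈ J)
    (hjα : α j ≠ 1) :
    (Finset.univ.filter fun m => m ∈ J ⊓ α.ker ∧ m⁻¹ * j * m ∈ H).card =
      Nat.card (H ⊓ α.ker : Subgroup G) := by
  obtain ⟨n, hn, h, hh, rfl⟩ := hE.exists_mul j hj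
  have hα : α (n * h) = α h := by rw [_root_.map_mul, MonoidHom.mem_ker.1 hn.2, one_mul]
  rw [hα] at hjα
  have h1 : (1 - (α h : ZMod p)) ≠ 0 := fun h0 => hjα (Units.ext (sub_eq_zero.1 h0).symm)
  rw [← hE.card_fiber (E n / (1 - (α h : ZMod p)))]
  congr 1
  refine Finset.filter_congr fun m _ => and_congr_right fun hm => ?_
  have hc := conj_mem (hE.le hh) hm
  have hM : m⁻¹ * n * (h * m * h⁻¹) ∈ J ⊓ α.ker := mul_mem (mul_mem (inv_mem hm) hn) hc
  have e : m⁻¹ * (n * h) * m = m⁻¹ * n * (h * m * h⁻¹) * h := by group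
  rw [e, H.mul_mem_cancel_right hh, ← hE.eq_zero_iff _ hM,
    hE.map_mul _ (mul_mem (inv_mem hm) hn) _ hc, hE.map_mul _ (inv_mem hm) _ hn, hE.map_inv hm,
    hE.map_conj _ (hE.le hh) _ hm, eq_div_iff h1]
  constructor <;> intro h2 <;> linear_combination -h2

variable [Finite G]

/-- Averaging over `J ⊓ ker α` the conjugates of the part of `H` outside `ker α`. -/
theorem conjSum_ind_sub [Fact p.Prime] (hE : AffineStep α H J E) :
    (p : ℂ) • conjSum (ind H - ind (H ⊓ α.ker)) = conjSum (ind J - ind (J ⊓ α.ker)) := by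
  classical
  have := Fintype.ofFinite G
  have hKpos : (Nat.card (H ⊓ α.ker : Subgroup G) : ℂ) ≠ 0 := by
    exact_mod_cast Nat.card_pos.ne'
  have key : ∑ m with m ∈ J ⊓ α.ker, (fun x => (ind H - ind (H ⊓ α.ker)) (m⁻¹ * x * m)) =
      (Nat.card (H ⊓ α.ker : Subgroup G) : ℂ) • (ind J - ind (J ⊓ α.ker)) := by
    ext x
    rw [Finset.sum_apply, Pi.smul_apply, Pi.sub_apply, smul_eq_mul]
    have hconjJ : ∀ m ∈ J ⊓ α.ker, m⁻¹ * x * m ∈ J ↔ x ∈ J := fun m hm => by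
      rw [J.mul_mem_cancel_right hm.1, J.mul_mem_cancel_left (inv_mem hm.1)]
    have hker : ∀ m ∈ J ⊓ α.ker, m⁻¹ * x * m ∈ α.ker ↔ x ∈ α.ker := fun m hm => by
      rw [α.ker.mul_mem_cancel_right hm.2, α.ker.mul_mem_cancel_left (inv_mem hm.2)]
    by_cases hxα : x ∈ α.ker
    · have h0 : ind J x - ind (J ⊓ α.ker) x = 0 := by
        simp [ind, hxα]
      rw [h0, mul_zero]
      refine Finset.sum_eq_zero fun m hm => ?_
      have := (hker m (Finset.mem_filter.1 hm).2).2 hxα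
      simp only [Pi.sub_apply, ind, Subgroup.mem_inf, this, and_true, sub_self]
    · have h0 : ind (J ⊓ α.ker) x = 0 := ind_of_notMem fun h => hxα h.2
      rw [h0, sub_zero]
      have h1 : ∀ m ∈ Finset.univ.filter (fun m => m ∈ J ⊓ α.ker),
          (ind H - ind (H ⊓ α.ker)) (m⁻¹ * x * m) = if m⁻¹ * x * m ∈ H then 1 else 0 := by
        intro m hm
        rw [Pi.sub_apply, ind_of_notMem (H := H ⊓ α.ker), sub_zero]
        · rfl
        · exact fun h => hxα ((hker m (Finset.mem_filter.1 hm).2).1 h.2)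
      rw [Finset.sum_congr rfl h1, Finset.sum_boole, Finset.filter_filter]
      by_cases hxJ : x ∈ J
      · rw [hE.card_conj_mem hxJ hxα, ind_of_mem hxJ, mul_one]
      · rw [ind_of_notMem hxJ, mul_zero, Nat.cast_eq_zero, Finset.card_eq_zero,
          Finset.filter_eq_empty_iff]
        exact fun m _ hm => hxJ ((hconjJ m hm.1).1 (hE.le hm.2))
  have h2 := congrArg conjSum key
  rw [conjSum_sum, conjSum_smul] at h2
  simp_rw [conjSum_conj] at h2
  rw [Finset.sum_const, ← Fintype.card_subtype, ← Nat.card_eq_fintype_card] at h2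
  have h3 : Nat.card {x // x ∈ J ⊓ α.ker} = p * Nat.card (H ⊓ α.ker : Subgroup G) := hE.card_ker
  rw [h3, ← Nat.cast_smul_eq_nsmul ℂ, Nat.cast_mul, mul_comm, mul_smul] at h2
  exact smul_right_injective _ hKpos h2

end AffineStep

end Chars

namespace Chars

variable {G : Type} [Group G]

theorem sum_eq_zero_add_sum_units {F M : Type*} [Field F] [Fintype F] [DecidableEq F]
    [AddCommMonoid M] (f : F → M) : ∑ x, f x = f 0 + ∑ u : Fˣ, f u := by
  rw [Fintype.sum_eq_add_sum_compl 0]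
  congr 1
  rw [← Fintype.sum_equiv unitsEquivNeZero.symm (fun x : {x : F // x ≠ 0} => f x) _ fun x => rfl]
  exact Finset.sum_subtype _ (by simp) _

/-- A linear character of `M` that is the composition of `E` and an additive character,
extended by zero. -/
def linChar {p : ℕ} [NeZero p] (M : Subgroup G) (E : G → ZMod p) (c : ZMod p) (x : G) : ℂ :=
  ZMod.stdAddChar (c * E x) * ind M x

section LinChar

variable {p : ℕ} [NeZero p] {M : Subgroup G} {E : G → ZMod p} {c : ZMod p}

theorem linChar_of_mem {x : G} (hx : x ∈ M) : linChar M E c x = ZMod.stdAddChar (c * E x) := by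
  rw [linChar, ind_of_mem hx, mul_one]

theorem linChar_of_notMem {x : G} (hx : x ∉ M) : linChar M E c x = 0 := by
  rw [linChar, ind_of_notMem hx, mul_zero]

theorem star_linChar : star (linChar M E c) = linChar M E (-c) := by
  ext x
  have := congrFun (star_ind M) x
  rw [Pi.star_apply] at this ⊢
  rw [linChar, linChar, star_mul', this, neg_mul, AddChar.map_neg_eq_conj]
  rfl

theorem linChar_zero : linChar M E 0 = ind M := by
  ext x
  simp [linChar]

theorem exists_selfConj_linChar [Finite G] (hE : ∀ x ∈ M, ∀ y ∈ M, E (x * y) = E x + E y) :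
    ∃ V W : FDRep ℂ G, V.character 1 = W.character 1 ∧ (Nat.card M : ℂ)⁻¹ •
      conjSum (linChar M E c + star (linChar M E c) - (2 : ℂ) • ind M) =
        (V.character - W.character) + star (V.character - W.character) := by
  have hE1 : E 1 = 0 := by
    have := hE 1 (one_mem M) 1 (one_mem M)
    rw [mul_one] at this
    exact left_eq_add.1 this
  exact exists_selfConj M (linChar M E c)
    (by rw [linChar_of_mem (one_mem M), hE1, mul_zero, AddChar.map_zero_eq_one])
    (fun g => linChar_of_notMem) (fun x hx y hy => by
      rw [linChar_of_mem hx, linChar_of_mem hy, linChar_of_mem (mul_mem hx hy), hE x hx y hy,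
        mul_add, AddChar.map_add_eq_mul])

theorem memP_linChar [Finite G] (hE : ∀ x ∈ M, ∀ y ∈ M, E (x * y) = E x + E y) :
    MemP G ((Nat.card M : ℂ)⁻¹ •
      conjSum (linChar M E c + star (linChar M E c) - (2 : ℂ) • ind M)) := by
  obtain ⟨V, W, h1, h2⟩ := exists_selfConj_linChar (c := c) hE
  rw [h2]
  exact .selfConj V W h1

end LinChar

/-- The two-dimensional representation of a dihedral group afforded by a character of its
rotation subgroup. -/
def dihedralRep {n : ℕ} [NeZero n] (c : ZMod n) :
    DihedralGroup n →* Matrix (Fin 2) (Fin 2) ℂ where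
  toFun
    | .r i => !![ZMod.stdAddChar (c * i), 0; 0, ZMod.stdAddChar (c * -i)]
    | .sr i => !![0, ZMod.stdAddChar (c * -i); ZMod.stdAddChar (c * i), 0]
  map_one' := by
    rw [DihedralGroup.one_def]
    ext i j
    fin_cases i <;> fin_cases j <;> simp
  map_mul' := by
    rintro (i | i) (j | j) <;> ext a b <;> fin_cases a <;> fin_cases b <;>
      simp [Matrix.mul_apply, ← AddChar.map_add_eq_mul] <;> ring_nf

theorem dihedralRep_r {n : ℕ} [NeZero n] (c i : ZMod n) : dihedralRep c (.r i) =
    !![ZMod.stdAddChar (c * i), 0; 0, ZMod.stdAddChar (c * -i)] := rfl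

theorem dihedralRep_sr {n : ℕ} [NeZero n] (c i : ZMod n) : dihedralRep c (.sr i) =
    !![0, ZMod.stdAddChar (c * -i); ZMod.stdAddChar (c * i), 0] := rfl

namespace AffineStep

variable {p : ℕ} {α : G →* (ZMod p)ˣ} {H J : Subgroup G} {E : G → ZMod p}

theorem sum_linChar [Fact p.Prime] (hE : AffineStep α H J E) :
    ∑ c : (ZMod p)ˣ, (linChar (J ⊓ α.ker) E c - ind (J ⊓ α.ker)) =
      (p : ℂ) • (ind (H ⊓ α.ker) - ind (J ⊓ α.ker)) := by
  have h1 := sum_eq_zero_add_sum_units fun c : ZMod p =>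
    linChar (J ⊓ α.ker) E c - ind (J ⊓ α.ker)
  rw [linChar_zero, sub_self, zero_add] at h1
  rw [← h1]
  ext x
  rw [Finset.sum_apply]
  by_cases hx : x ∈ J ⊓ α.ker
  · have h2 : ind (H ⊓ α.ker) x = if E x = 0 then 1 else 0 := by
      have : x ∈ H ⊓ α.ker ↔ E x = 0 := by
        rw [hE.eq_zero_iff x hx, Subgroup.mem_inf, and_iff_left (show x ∈ α.ker from hx.2)]
      simp only [ind, this]
    simp only [Pi.sub_apply, linChar_of_mem hx, Finset.sum_sub_distrib, Pi.smul_apply, ind_of_mem hx,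
      h2, AddChar.sum_mulShift _ (ZMod.isPrimitive_stdAddChar p)]
    split_ifs <;> simp [ZMod.card]
  · have hx' : x ∉ H ⊓ α.ker := fun h => hx ⟨hE.le h.1, h.2⟩
    simp [linChar_of_notMem hx, ind_of_notMem hx, ind_of_notMem hx']

variable [Finite G]

theorem smul_permChar_sub [Fact p.Prime] (hE : AffineStep α H J E) {n : ℕ}
    (hn : Nat.card (H.map α) * n = p - 1) :
    (Nat.card (H.map α) : ℂ) • (permChar H - permChar J - n • permChar (J ⊓ α.ker)) =
      (Nat.card (J ⊓ α.ker : Subgroup G) : ℂ)⁻¹ •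
        conjSum ((p : ℂ) • (ind (H ⊓ α.ker) - ind (J ⊓ α.ker))) := by
  have hn' : (Nat.card (H.map α) : ℂ) * n = p - 1 := by
    rw [← Nat.cast_mul, hn, Nat.cast_sub (Fact.out : p.Prime).one_le, Nat.cast_one]
  have ha : (Nat.card (H.map α) : ℂ) ≠ 0 := by exact_mod_cast Nat.card_pos.ne'
  have hk : (Nat.card (H ⊓ α.ker : Subgroup G) : ℂ) ≠ 0 := by exact_mod_cast Nat.card_pos.ne'
  have hp : (p : ℂ) ≠ 0 := by exact_mod_cast (Fact.out : p.Prime).ne_zero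
  have h1 := card_eq_card_map_mul_card_inf_ker α H
  have h2 := card_eq_card_map_mul_card_inf_ker α J
  rw [← hE.map_eq] at h2
  have h3 := hE.conjSum_ind_sub
  rw [conjSum_sub, conjSum_sub] at h3
  rw [permChar_eq, permChar_eq, permChar_eq, h1, h2, hE.card_ker, conjSum_smul, conjSum_sub]
  ext g
  have h4 := congrFun h3 g
  simp only [Pi.smul_apply, Pi.sub_apply, smul_eq_mul, nsmul_eq_mul, Pi.mul_apply,
    Nat.cast_mul, Pi.natCast_apply] at h4 ⊢
  set a : ℂ := ((Nat.card (H.map α) : ℕ) : ℂ)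
  set k : ℂ := ((Nat.card (H ⊓ α.ker : Subgroup G) : ℕ) : ℂ)
  set u := conjSum (ind H) g
  set v := conjSum (ind J) g
  set w := conjSum (ind (H ⊓ α.ker)) g
  set z := conjSum (ind (J ⊓ α.ker)) g
  field_simp
  linear_combination h4 - z * hn'

theorem apply_eq_zero [Fact p.Prime] (hp2 : p ≠ 2) (hE : AffineStep α H J E) {n : ℕ}
    (hn : Nat.card (H.map α) * n = p - 1) (g : G) (k : ℕ) (hg : g ^ 2 ^ k = 1) :
    (permChar H - permChar J - n • permChar (J ⊓ α.ker)) g = 0 := by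
  have := Fintype.ofFinite G
  have ha : (Nat.card (H.map α) : ℂ) ≠ 0 := by exact_mod_cast Nat.card_pos.ne'
  refine (mul_eq_zero.1 (?_ : (Nat.card (H.map α) : ℂ) * _ = 0)).resolve_left ha
  have h1 := congrFun (hE.smul_permChar_sub hn) g
  rw [Pi.smul_apply, smul_eq_mul] at h1
  rw [h1, Pi.smul_apply, conjSum_apply, Finset.sum_eq_zero, smul_zero]
  intro x _
  have hy : (x⁻¹ * g * x) ^ 2 ^ k = 1 := by
    have : (x⁻¹ * g * x) ^ 2 ^ k = x⁻¹ * g ^ 2 ^ k * x := by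
      simpa using conj_pow (a := x⁻¹) (b := g) (i := 2 ^ k)
    rw [this, hg, mul_one, inv_mul_cancel]
  generalize x⁻¹ * g * x = y at hy
  by_cases hM : y ∈ J ⊓ α.ker
  · have h2 := hE.map_pow hM (2 ^ k)
    rw [hy, hE.map_one, eq_comm, mul_eq_zero] at h2
    have h3 : E y = 0 := by
      refine h2.resolve_left fun h0 => hp2 ?_
      rw [ZMod.natCast_eq_zero_iff] at h0
      exact (Nat.prime_dvd_prime_iff_eq Fact.out Nat.prime_two).1
        ((Fact.out : p.Prime).dvd_of_dvd_pow h0)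
    have h4 : y ∈ H ⊓ α.ker := ⟨(hE.eq_zero_iff y hM).1 h3, hM.2⟩
    simp [ind_of_mem hM, ind_of_mem h4]
  · have h4 : y ∉ H ⊓ α.ker := fun h => hM ⟨hE.le h.1, h.2⟩
    simp [ind_of_notMem hM, ind_of_notMem h4]

end AffineStep

end Chars

namespace Chars

theorem eq_one_or_eq_of_mem_zpowers {A : Type*} [Group A] {a b : A} (ha : a * a = 1)
    (hb : b ∈ Subgroup.zpowers a) : b = 1 ∨ b = a := by
  obtain ⟨k, rfl⟩ := hb
  have ha' : a ^ (2 : ℤ) = 1 := by rw [zpow_two, ha]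
  rcases Int.even_or_odd' k with ⟨l, rfl | rfl⟩
  · left
    simp only [zpow_mul, ha', one_zpow]
  · right
    simp only [zpow_add, zpow_mul, ha', one_zpow, one_mul, zpow_one]

theorem ZMod.neg_one_units_ne_one {p : ℕ} [Fact p.Prime] (hp2 : p ≠ 2) : (-1 : (ZMod p)ˣ) ≠ 1 := by
  intro h
  have : Fact (2 < p) := ⟨lt_of_le_of_ne (Fact.out : p.Prime).two_le hp2.symm⟩
  exact ZMod.neg_one_ne_one (by simpa using congrArg Units.val h)

variable {G : Type} [Group G]

namespace AffineStep

variable {p : ℕ} {α : G →* (ZMod p)ˣ} {H J : Subgroup G} {E : G → ZMod p}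

/-- The part of `J` acting by a sign on `ZMod p`. -/
def signPart (α : G →* (ZMod p)ˣ) (J : Subgroup G) : Subgroup G :=
  J ⊓ (Subgroup.zpowers (-1)).comap α

theorem eq_or_of_mem_signPart {x : G} (hx : x ∈ signPart α J) : α x = 1 ∨ α x = -1 :=
  eq_one_or_eq_of_mem_zpowers (by simp) hx.2

theorem ker_le_signPart : J ⊓ α.ker ≤ signPart α J := fun x hx =>
  ⟨hx.1, by
    have : α x = 1 := hx.2
    simp [this]⟩

theorem card_signPart [Finite G] [Fact p.Prime] (hp2 : p ≠ 2) (h : -1 ∈ J.map α) :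
    Nat.card (signPart α J) = 2 * Nat.card (J ⊓ α.ker : Subgroup G) := by
  have h1 : (signPart α J).map α = Subgroup.zpowers (-1) := by
    refine le_antisymm ?_ ?_
    · rintro _ ⟨x, hx, rfl⟩
      exact hx.2
    · rw [Subgroup.zpowers_le]
      obtain ⟨x, hx, hx'⟩ := h
      exact ⟨x, ⟨hx, by simp [hx']⟩, hx'⟩
  have h2 : signPart α J ⊓ α.ker = J ⊓ α.ker :=
    le_antisymm (inf_le_inf_right _ inf_le_left) (le_inf ker_le_signPart inf_le_right)
  rw [card_eq_card_map_mul_card_inf_ker α, h1, h2, Nat.card_zpowers,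
    orderOf_eq_prime (p := 2) (by simp) (ZMod.neg_one_units_ne_one hp2)]

open scoped Classical in
/-- The homomorphism to a dihedral group defined by an element `t` of `H` acting as `-1`. -/
def toDihedral [Fact p.Prime] (hp2 : p ≠ 2) (hE : AffineStep α H J E) {t : G} (ht : t ∈ H)
    (htα : α t = -1) : signPart α J →* DihedralGroup p where
  toFun x := if α x = 1 then .r (E x) else .sr (E (t⁻¹ * x))
  map_one' := by simp [hE.map_one]
  map_mul' := by
    have hne := ZMod.neg_one_units_ne_one (p := p) hp2
    have htJ := hE.le ht
    have hneg : ∀ x : signPart α J, α x = -1 → t⁻¹ * (x : G) ∈ J ⊓ α.ker := fun x hx =>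
      ⟨J.mul_mem (J.inv_mem htJ) x.2.1, by
        change α (t⁻¹ * x) = 1
        rw [_root_.map_mul, _root_.map_inv, htα, hx]
        simp⟩
    have hpos : ∀ x : signPart α J, α x = 1 → (x : G) ∈ J ⊓ α.ker := fun x hx => ⟨x.2.1, hx⟩
    intro x y
    rcases eq_or_of_mem_signPart x.2 with hx | hx <;> rcases eq_or_of_mem_signPart y.2 with hy | hy
    · simp [hx, hy, hE.map_mul _ (hpos x hx) _ (hpos y hy)]
    · have e : t⁻¹ * ((x : G) * y) = (t⁻¹ * x * t⁻¹⁻¹) * (t⁻¹ * y) := by group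
      have htx := hE.map_conj t⁻¹ (inv_mem htJ) x (hpos x hx)
      simp only [Subgroup.coe_mul, _root_.map_mul, hx, hy, one_mul, hne, if_false, if_true,
        DihedralGroup.r_mul_sr]
      rw [e, hE.map_mul _ (conj_mem (inv_mem htJ) (hpos x hx)) _ (hneg y hy), htx, _root_.map_inv,
        htα]
      simp
      ring
    · have e : t⁻¹ * ((x : G) * y) = (t⁻¹ * x) * y := by group
      simp only [Subgroup.coe_mul, _root_.map_mul, hx, hy, mul_one, hne, if_false, if_true,
        DihedralGroup.sr_mul_r]
      rw [e, hE.map_mul _ (hneg x hx) _ (hpos y hy)]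
    · have htt : t * t ∈ J ⊓ α.ker := ⟨J.mul_mem htJ htJ, by
        change α (t * t) = 1
        simp [htα]⟩
      have ett : E (t * t) = 0 := (hE.eq_zero_iff _ htt).2 (mul_mem ht ht)
      have e : (x : G) * y = (t * (t⁻¹ * x) * t⁻¹) * ((t * t) * (t⁻¹ * y)) := by group
      have htx := hE.map_conj t htJ _ (hneg x hx)
      simp only [Subgroup.coe_mul, _root_.map_mul, hx, hy, mul_neg, neg_neg, mul_one, hne, if_false,
        if_true, DihedralGroup.sr_mul_sr]
      rw [e, hE.map_mul _ (conj_mem htJ (hneg x hx)) _ (mul_mem htt (hneg y hy)), htx,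
        hE.map_mul _ htt _ (hneg y hy), ett, htα]
      simp
      ring

theorem toDihedral_of_eq_one [Fact p.Prime] (hp2 : p ≠ 2) (hE : AffineStep α H J E) {t : G}
    (ht : t ∈ H) (htα : α t = -1) {x : signPart α J} (hx : α x = 1) :
    toDihedral hp2 hE ht htα x = .r (E x) := if_pos hx

theorem toDihedral_of_ne_one [Fact p.Prime] (hp2 : p ≠ 2) (hE : AffineStep α H J E) {t : G}
    (ht : t ∈ H) (htα : α t = -1) {x : signPart α J} (hx : α x ≠ 1) :
    toDihedral hp2 hE ht htα x = .sr (E (t⁻¹ * x)) := if_neg hx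

theorem toDihedral_surjective [Fact p.Prime] (hp2 : p ≠ 2) (hE : AffineStep α H J E) {t : G}
    (ht : t ∈ H) (htα : α t = -1) : Function.Surjective (toDihedral hp2 hE ht htα) := by
  rintro (i | i) <;> obtain ⟨x, hx, rfl⟩ := hE.exists_eq i
  · exact ⟨⟨x, ker_le_signPart hx⟩, toDihedral_of_eq_one hp2 hE ht htα hx.2⟩
  · have hxα : α x = 1 := hx.2
    have htx : α (t * x) = -1 := by rw [_root_.map_mul, htα, hxα, mul_one]
    refine ⟨⟨t * x, J.mul_mem (hE.le ht) hx.1, by simp [htx]⟩, ?_⟩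
    rw [toDihedral_of_ne_one hp2 hE ht htα]
    · simp
    · rw [htx]
      exact ZMod.neg_one_units_ne_one hp2

variable [Finite G]

theorem memP_half [Fact p.Prime] (hp2 : p ≠ 2) (hE : AffineStep α H J E) (h : -1 ∈ J.map α)
    (c : ZMod p) :
    MemP G ((2 * Nat.card (J ⊓ α.ker : Subgroup G) : ℂ)⁻¹ • conjSum
      (linChar (J ⊓ α.ker) E c + star (linChar (J ⊓ α.ker) E c) - (2 : ℂ) • ind (J ⊓ α.ker))) := by
  have h' := h
  rw [← hE.map_eq] at h'
  obtain ⟨t, ht, htα⟩ := h'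
  let f := toDihedral hp2 hE ht htα
  have hf := toDihedral_surjective hp2 hE ht htα
  let τ := matRep ((dihedralRep c).comp f)
  have hτ := MemP.dihedralInd (G := G) (signPart α J) τ
    (by rw [matRep_character, _root_.map_one]; simp)
    f.ker
    (by
      intro n x hn
      rw [matRep_character, matRep_character, _root_.map_mul, MonoidHom.comp_apply,
        MonoidHom.mem_ker.1 hn, _root_.map_one, one_mul])
    (Or.inr (Or.inr ⟨p, Fact.out, (Fact.out : p.Prime).odd_of_ne_two hp2,
      ⟨QuotientGroup.quotientKerEquivOfSurjective f hf⟩⟩))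
  rw [indChar_eq _ _ (linChar (J ⊓ α.ker) E c + star (linChar (J ⊓ α.ker) E c) -
    (2 : ℂ) • ind (J ⊓ α.ker)), card_signPart hp2 h] at hτ
  · exact_mod_cast hτ
  · intro x
    rw [star_linChar]
    simp only [Pi.sub_apply, Pi.add_apply, Pi.smul_apply, smul_eq_mul, Pi.one_apply, τ,
      matRep_character, detChar_matRep, MonoidHom.comp_apply, f]
    by_cases hx : α x = 1
    · have hxM : (x : G) ∈ J ⊓ α.ker := ⟨x.2.1, hx⟩
      rw [toDihedral_of_eq_one hp2 hE ht htα hx, dihedralRep_r, linChar_of_mem hxM,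
        linChar_of_mem hxM, ind_of_mem hxM, Matrix.trace_fin_two_of, Matrix.det_fin_two_of,
        ← AddChar.map_add_eq_mul, ← mul_add, add_neg_cancel, mul_zero, AddChar.map_zero_eq_one,
        mul_neg, neg_mul]
      ring
    · have hxM : (x : G) ∉ J ⊓ α.ker := fun h => hx h.2
      rw [toDihedral_of_ne_one hp2 hE ht htα hx, dihedralRep_sr, linChar_of_notMem hxM,
        linChar_of_notMem hxM, ind_of_notMem hxM, Matrix.trace_fin_two_of, Matrix.det_fin_two_of,
        ← AddChar.map_add_eq_mul, ← mul_add, neg_add_cancel]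
      simp
  · intro x hx
    have hxM : x ∉ J ⊓ α.ker := fun h => hx (ker_le_signPart h)
    rw [star_linChar]
    simp [linChar_of_notMem hxM, ind_of_notMem hxM]

/-- The function `Ind (χ + χ̄ - 2)` for the linear character `χ` of `J ⊓ ker α` attached to `c`. -/
def indSum (α : G →* (ZMod p)ˣ) (J : Subgroup G) (E : G → ZMod p) [NeZero p] (c : (ZMod p)ˣ) :
    G → ℂ :=
  (Nat.card (J ⊓ α.ker : Subgroup G) : ℂ)⁻¹ • conjSum
      (linChar (J ⊓ α.ker) E c + star (linChar (J ⊓ α.ker) E c) - (2 : ℂ) • ind (J ⊓ α.ker))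

theorem indSum_neg [Fact p.Prime] (c : (ZMod p)ˣ) : indSum α J E (-c) = indSum α J E c := by
  rw [indSum, indSum, star_linChar, star_linChar, Units.val_neg, neg_neg, add_comm (linChar _ _ _)]

theorem indSum_mul [Fact p.Prime] (hE : AffineStep α H J E) (c : (ZMod p)ˣ) {j : G} (hj : j ∈ J) :
    indSum α J E (c * α j) = indSum α J E c := by
  rw [indSum, indSum]
  congr 1
  refine Eq.trans ?_ (conjSum_conj _ j⁻¹)
  congr 1
  ext x
  have hmem : x ∈ J ⊓ α.ker ↔ j⁻¹⁻¹ * x * j⁻¹ ∈ J ⊓ α.ker := by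
    rw [inv_inv]
    refine ⟨conj_mem hj, fun h => ?_⟩
    have := conj_mem (inv_mem hj) h
    convert this using 1
    group
  rw [star_linChar, star_linChar]
  simp only [Pi.sub_apply, Pi.add_apply, Pi.smul_apply, smul_eq_mul]
  by_cases hx : x ∈ J ⊓ α.ker
  · have hx' := hmem.1 hx
    rw [linChar_of_mem hx, linChar_of_mem hx, linChar_of_mem hx', linChar_of_mem hx', ind_of_mem hx,
      ind_of_mem hx', inv_inv, hE.map_conj j hj x hx, Units.val_mul]
    ring_nf
  · have hx' := fun h => hx (hmem.2 h)
    rw [linChar_of_notMem hx, linChar_of_notMem hx, linChar_of_notMem hx', linChar_of_notMem hx',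
      ind_of_notMem hx, ind_of_notMem hx']

theorem sum_indSum [Fact p.Prime] (hE : AffineStep α H J E) {n : ℕ}
    (hn : Nat.card (H.map α) * n = p - 1) :
    ∑ c : (ZMod p)ˣ, indSum α J E c =
      Nat.card (H.map α) • (2 : ℂ) • (permChar H - permChar J - n • permChar (J ⊓ α.ker)) := by
  have h1 := hE.sum_linChar
  have h2 := congrArg star h1
  rw [star_sum, star_smul, star_sub, star_ind, star_ind] at h2
  simp only [star_sub, star_ind] at h2
  have h3 : star (p : ℂ) = p := by simp
  rw [h3] at h2
  have h4 := hE.smul_permChar_sub hn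
  have h5 : ∑ c : (ZMod p)ˣ, (linChar (J ⊓ α.ker) E c + star (linChar (J ⊓ α.ker) E c) -
      (2 : ℂ) • ind (J ⊓ α.ker)) = (2 : ℂ) • (p : ℂ) • (ind (H ⊓ α.ker) - ind (J ⊓ α.ker)) := by
    rw [two_smul ℂ ((p : ℂ) • _)]
    nth_rw 1 [← h1]
    rw [← h2, ← Finset.sum_add_distrib]
    refine Finset.sum_congr rfl fun c _ => ?_
    rw [two_smul]
    abel
  simp only [indSum]
  rw [← Finset.smul_sum, ← conjSum_sum, h5, conjSum_smul, smul_comm, ← h4,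
    ← Nat.cast_smul_eq_nsmul ℂ (Nat.card (H.map α)), smul_comm]

theorem memP [Fact p.Prime] (hp2 : p ≠ 2) (hE : AffineStep α H J E) {n : ℕ}
    (hn : Nat.card (H.map α) * n = p - 1) :
    MemP G (permChar H - permChar J - n • permChar (J ⊓ α.ker)) := by
  classical
  let A := J.map α
  have hA : Nat.card (H.map α) ≠ 0 := Nat.card_pos.ne'
  have hinv : ∀ c, ∀ a ∈ A, indSum α J E (c * a) = indSum α J E c := by
    rintro c _ ⟨j, hj, rfl⟩
    exact hE.indSum_mul c hj
  have h1 := sum_eq_card_mul_sum_out A (indSum α J E) hinv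
  rw [hE.sum_indSum hn] at h1
  have h2 : (2 : ℂ) • (permChar H - permChar J - n • permChar (J ⊓ α.ker)) =
      ∑ q : (ZMod p)ˣ ⧸ A, indSum α J E q.out := by
    refine smul_right_injective _ hA (h1.trans ?_)
    rw [hE.map_eq]
  have hmem : ∀ c, MemP G (indSum α J E c) := fun c => memP_linChar hE.map_mul
  by_cases hneg : -1 ∈ A
  · have h3 : permChar H - permChar J - n • permChar (J ⊓ α.ker) =
        ∑ q : (ZMod p)ˣ ⧸ A, (2 : ℂ)⁻¹ • indSum α J E q.out := by
      rw [← Finset.smul_sum, ← h2, inv_smul_smul₀ two_ne_zero]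
    rw [h3, ← mem_memPGroup]
    refine sum_mem fun q _ => ?_
    have := hE.memP_half hp2 hneg q.out
    rwa [mul_inv, mul_smul] at this
  · let x : (ZMod p)ˣ ⧸ A := QuotientGroup.mk (-1)
    have hx2 : x * x = 1 := by
      rw [← QuotientGroup.mk_mul]
      simp
    have hx1 : x ≠ 1 := fun h => hneg ((QuotientGroup.eq_one_iff _).1 h)
    have hord : Nat.card (Subgroup.zpowers x) = 2 := by
      rw [Nat.card_zpowers, orderOf_eq_prime (by rw [pow_two, hx2]) hx1]
    have hout : ∀ c, indSum α J E (QuotientGroup.mk c : (ZMod p)ˣ ⧸ A).out = indSum α J E c := by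
      intro c
      obtain ⟨a, ha⟩ := QuotientGroup.mk_out_eq_mul A c
      rw [ha, hinv _ _ a.2]
    have h3 := sum_eq_card_mul_sum_out (Subgroup.zpowers x)
      (fun q : (ZMod p)ˣ ⧸ A => indSum α J E q.out) (by
        intro q y hy
        rcases eq_one_or_eq_of_mem_zpowers hx2 hy with rfl | rfl
        · rw [mul_one]
        · obtain ⟨c, rfl⟩ := QuotientGroup.mk_surjective q
          simp only [x]
          rw [← QuotientGroup.mk_mul, hout, hout, mul_neg_one, indSum_neg])
    rw [hord, ← h2, ← Nat.cast_smul_eq_nsmul ℂ 2, Nat.cast_ofNat] at h3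
    rw [smul_right_injective _ (two_ne_zero (α := ℂ)) h3, ← mem_memPGroup]
    exact sum_mem fun q _ => hmem _

end AffineStep

end Chars

namespace Chars

variable {G : Type} [Group G]

theorem exists_exponent (H : Subgroup G) (ℓ : G) (m : ℕ) (h : ∀ i : ℤ, ℓ ^ i ∈ H → (m : ℤ) ∣ i) :
    ∃ E : G → ZMod m, ∀ k ∈ H, ∀ i : ℤ, E (k * ℓ ^ i) = i := by
  classical
  let P : G → ℤ → Prop := fun x i => x * ℓ ^ (-i) ∈ H
  refine ⟨fun x => if hx : ∃ i, P x i then (hx.choose : ZMod m) else 0, fun k hk i => ?_⟩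
  have hx : ∃ j, P (k * ℓ ^ i) j := ⟨i, by simpa [P] using hk⟩
  simp only [dif_pos hx]
  have h1 : k * ℓ ^ i * ℓ ^ (-hx.choose) ∈ H := hx.choose_spec
  rw [mul_assoc, H.mul_mem_cancel_left hk, ← zpow_add, ← sub_eq_add_neg] at h1
  rw [ZMod.intCast_eq_intCast_iff_dvd_sub]
  exact h _ h1

theorem conj_zpow_eq {g x : G} {m : ℤ} (h : x * g * x⁻¹ = g ^ m) (i : ℤ) :
    x * g ^ i * x⁻¹ = (g ^ i) ^ m := by
  rw [← zpow_mul, mul_comm, zpow_mul, ← h, conj_zpow]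

theorem exists_conj_eq_zpow {g : G} (hN : (Subgroup.zpowers g).Normal) (x : G) :
    ∃ m : ℤ, x * g * x⁻¹ = g ^ m := by
  obtain ⟨m, hm⟩ := hN.conj_mem g (Subgroup.mem_zpowers g) x
  exact ⟨m, hm.symm⟩

/-- The action of `G` by conjugation on a normal cyclic subgroup, modulo a divisor of its order. -/
theorem exists_conjChar {g : G} (hN : (Subgroup.zpowers g).Normal) {p : ℕ} (hp : p ∣ orderOf g) :
    ∃ α : G →* (ZMod p)ˣ, ∀ x, ∀ m : ℤ, x * g * x⁻¹ = g ^ m → (α x : ZMod p) = m := by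
  choose e he using exists_conj_eq_zpow hN
  have key : ∀ x, ∀ m : ℤ, x * g * x⁻¹ = g ^ m → (e x : ZMod p) = m := by
    intro x m hm
    rw [ZMod.intCast_eq_intCast_iff_dvd_sub]
    refine (Int.natCast_dvd_natCast.2 hp).trans (orderOf_dvd_iff_zpow_eq_one.2 ?_)
    rw [zpow_sub, ← hm, he, mul_inv_cancel]
  let f : G →* ZMod p :=
    { toFun := fun x => e x
      map_one' := by
        rw [key 1 1 (by simp), Int.cast_one]
      map_mul' := fun x y => by
        rw [key (x * y) (e x * e y), Int.cast_mul]
        have h1 := conj_zpow_eq (he x) (e y)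
        have h2 : x * y * g * (x * y)⁻¹ = x * (y * g * y⁻¹) * x⁻¹ := by group
        rw [h2, he y, h1, ← zpow_mul, mul_comm] }
  exact ⟨f.toHomUnits, fun x m hm => key x m hm⟩

theorem exists_affineStep [Finite G] {p k : ℕ} [Fact p.Prime] {g : G}
    (hN : (Subgroup.zpowers g).Normal) (hord : orderOf g = p ^ k) {H : Subgroup G} (hg : g ∉ H) :
    ∃ (α : G →* (ZMod p)ˣ) (ℓ : G) (E : G → ZMod p), ℓ ∈ Subgroup.zpowers g ∧ ℓ ∉ H ∧
      Subgroup.zpowers g ≤ α.ker ∧ AffineStep α H (H ⊔ Subgroup.zpowers ℓ) E := by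
  classical
  have hpp : p.Prime := Fact.out
  have hex : ∃ j, g ^ p ^ j ∈ H := ⟨k, by rw [← hord, pow_orderOf_eq_one]; exact one_mem H⟩
  obtain ⟨j, hj⟩ : ∃ j, Nat.find hex = j + 1 := by
    refine Nat.exists_eq_succ_of_ne_zero fun h0 => hg ?_
    have := Nat.find_spec hex
    rwa [h0, pow_zero, pow_one] at this
  have hdvd : p ∣ orderOf g := by
    rw [hord]
    refine dvd_pow_self p fun h0 => hg ?_
    rw [h0, pow_zero, orderOf_eq_one_iff] at hord
    rw [hord]
    exact one_mem H
  obtain ⟨α, hα⟩ := exists_conjChar hN hdvd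
  set ℓ := g ^ p ^ j with hℓ
  have hℓN : ℓ ∈ Subgroup.zpowers g := pow_mem (Subgroup.mem_zpowers g) _
  have hℓH : ℓ ∉ H := Nat.find_min hex (by omega)
  have hℓp : ℓ ^ (p : ℤ) ∈ H := by
    have := Nat.find_spec hex
    rw [hj, pow_succ, pow_mul] at this
    rwa [zpow_natCast]
  have hdvd : ∀ i : ℤ, ℓ ^ i ∈ H ↔ (p : ℤ) ∣ i := by
    intro i
    constructor
    · intro hi
      by_contra hpi
      have hcop : IsCoprime (p : ℤ) i :=
        (Prime.coprime_iff_not_dvd (Nat.prime_iff_prime_int.1 hpp)).2 hpi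
      obtain ⟨a, b, hab⟩ := hcop
      refine hℓH ?_
      rw [← zpow_one ℓ, ← hab, zpow_add, mul_comm a, mul_comm b, zpow_mul, zpow_mul]
      exact mul_mem (zpow_mem hℓp _) (zpow_mem hi _)
    · rintro ⟨c, rfl⟩
      rw [zpow_mul]
      exact zpow_mem hℓp _
  have hker : Subgroup.zpowers g ≤ α.ker := by
    rw [Subgroup.zpowers_le]
    refine Units.ext ?_
    rw [hα g 1 (by simp)]
    simp
  have hconj : ∀ x, ∃ m : ℤ, (α x : ZMod p) = m ∧ ∀ i : ℤ, x * ℓ ^ i * x⁻¹ = ℓ ^ (i * m) := by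
    intro x
    obtain ⟨m, hm⟩ := exists_conj_eq_zpow hN x
    refine ⟨m, hα x m hm, fun i => ?_⟩
    have := conj_zpow_eq hm ((p ^ j : ℕ) * i)
    rwa [zpow_mul, zpow_natCast, ← hℓ, ← zpow_mul] at this
  have hconj1 : ∀ x ∈ α.ker, ∃ m : ℤ, ∀ i : ℤ, x * ℓ ^ i * x⁻¹ = ℓ ^ (i + p * (i * m)) := by
    intro x hx
    obtain ⟨m, hm, hm'⟩ := hconj x
    rw [MonoidHom.mem_ker] at hx
    rw [hx, Units.val_one, ← Int.cast_one, ZMod.intCast_eq_intCast_iff_dvd_sub] at hm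
    obtain ⟨c, hc⟩ := hm
    refine ⟨c, fun i => ?_⟩
    rw [hm', eq_add_of_sub_eq hc]
    congr 1
    ring
  have hLnormal : (Subgroup.zpowers ℓ).Normal := by
    refine ⟨?_⟩
    rintro _ ⟨i, rfl⟩ x
    obtain ⟨m, -, hm⟩ := hconj x
    exact ⟨i * m, (hm i).symm⟩
  have hJ : ∀ x, x ∈ H ⊔ Subgroup.zpowers ℓ ↔ ∃ h ∈ H, ∃ i : ℤ, x = h * ℓ ^ i := by
    intro x
    rw [Subgroup.mem_sup_of_normal_right]
    simp [Subgroup.mem_zpowers_iff, eq_comm]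
  have hM : ∀ x ∈ (H ⊔ Subgroup.zpowers ℓ) ⊓ α.ker, ∃ h ∈ H, h ∈ α.ker ∧ ∃ i : ℤ, x = h * ℓ ^ i := by
    intro x hx
    obtain ⟨h, hh, i, rfl⟩ := (hJ x).1 hx.1
    refine ⟨h, hh, ?_, i, rfl⟩
    have h2 : ℓ ^ i ∈ α.ker := hker (zpow_mem hℓN i)
    exact (α.ker.mul_mem_cancel_right h2).1 hx.2
  obtain ⟨E, hE⟩ := exists_exponent H ℓ p fun i => (hdvd i).1
  have hEℓ : ∀ i : ℤ, E (ℓ ^ i) = i := fun i => by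
    simpa using hE 1 (one_mem H) i
  refine ⟨α, ℓ, E, hℓN, hℓH, hker, ⟨le_sup_left, ?_, ?_, ?_, ?_, ?_⟩⟩
  · intro x hx y hy
    obtain ⟨a, ha, -, i, rfl⟩ := hM x hx
    obtain ⟨b, hb, hbα, l, rfl⟩ := hM y hy
    obtain ⟨m, hm⟩ := hconj1 b⁻¹ (inv_mem hbα)
    have e : a * ℓ ^ i * (b * ℓ ^ l) = a * b * ℓ ^ (i + p * (i * m) + l) := by
      rw [zpow_add, ← hm i]
      group
    rw [e, hE _ (mul_mem ha hb), hE _ ha, hE _ hb]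
    simp
  · intro y hy x hx
    obtain ⟨a, ha, haα, i, rfl⟩ := hM x hx
    obtain ⟨h, hh, s, rfl⟩ := (hJ y).1 hy
    obtain ⟨m, hm⟩ := hconj1 a⁻¹ (inv_mem haα)
    obtain ⟨r, hr, hr'⟩ := hconj (h * ℓ ^ s)
    have e : h * ℓ ^ s * (a * ℓ ^ i) * (h * ℓ ^ s)⁻¹ =
        h * a * ℓ ^ ((p : ℤ) * (s * m)) * h⁻¹ * ℓ ^ (i * r) := by
      have e1 : ℓ ^ ((p : ℤ) * (s * m)) = (ℓ ^ s)⁻¹ * (a⁻¹ * ℓ ^ s * a⁻¹⁻¹) := by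
        rw [hm s, zpow_add, inv_mul_cancel_left]
      have e2 : (ℓ ^ s)⁻¹ * (a⁻¹ * ℓ ^ s * a⁻¹⁻¹) = (a⁻¹ * ℓ ^ s * a⁻¹⁻¹) * (ℓ ^ s)⁻¹ := by
        rw [hm s]
        group
      rw [← hr' i, e1, e2]
      group
    rw [e, hE _ (mul_mem (mul_mem (mul_mem hh ha) ((hdvd _).2 (dvd_mul_right _ _))) (inv_mem hh)),
      hE _ ha, hr]
    push_cast
    ring
  · intro x hx
    obtain ⟨a, ha, -, i, rfl⟩ := hM x hx
    rw [hE _ ha, H.mul_mem_cancel_left ha, hdvd, ZMod.intCast_zmod_eq_zero_iff_dvd]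
  · refine ⟨ℓ, ⟨Subgroup.mem_sup_right (Subgroup.mem_zpowers ℓ), hker hℓN⟩, ?_⟩
    simpa using hEℓ 1
  · intro x hx
    obtain ⟨h, hh, i, rfl⟩ := (hJ x).1 hx
    refine ⟨h * ℓ ^ i * h⁻¹, ?_, h, hh, by group⟩
    obtain ⟨m, -, hm⟩ := hconj h
    rw [hm]
    exact ⟨Subgroup.mem_sup_right (zpow_mem (Subgroup.mem_zpowers ℓ) _), hker (zpow_mem hℓN _)⟩

end Chars

namespace Chars

variable {G : Type} [Group G] [Finite G]

/-- Functions which modulo `P_G` are inflated from `G/N` by a permutation character with the same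
values on elements of order a power of two. -/
def twoInflated (N : Subgroup G) [N.Normal] : AddSubgroup (G → ℂ) where
  carrier := {χ | ∃ h ∈ permGroup (G ⧸ N), (χ - fun g : G => h g) ∈ memPGroup G ∧
    ∀ (g : G) (k : ℕ), g ^ 2 ^ k = 1 → χ g = h g}
  zero_mem' := ⟨0, zero_mem _, sub_mem (zero_mem (memPGroup G)) (zero_mem (memPGroup G)), by simp⟩
  add_mem' := by
    rintro χ ψ ⟨h, h1, h2, h3⟩ ⟨h', h1', h2', h3'⟩
    refine ⟨h + h', add_mem h1 h1', ?_, fun g k hg => ?_⟩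
    · convert add_mem h2 h2' using 1
      ext g
      simp only [Pi.sub_apply, Pi.add_apply]
      ring
    · rw [Pi.add_apply, Pi.add_apply, h3 g k hg, h3' g k hg]
  neg_mem' := by
    rintro χ ⟨h, h1, h2, h3⟩
    refine ⟨-h, neg_mem h1, ?_, fun g k hg => ?_⟩
    · convert neg_mem h2 using 1
      ext g
      simp only [Pi.sub_apply, Pi.neg_apply]
      ring
    · rw [Pi.neg_apply, Pi.neg_apply, h3 g k hg]

theorem mem_twoInflated_of_memP {N : Subgroup G} [N.Normal] {χ : G → ℂ} (hχ : MemP G χ)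
    (h : ∀ (g : G) (k : ℕ), g ^ 2 ^ k = 1 → χ g = 0) : χ ∈ twoInflated N :=
  ⟨0, zero_mem _, by simpa [mem_memPGroup, ← Pi.zero_def] using hχ, h⟩

theorem permChar_mem_twoInflated {p k : ℕ} [Fact p.Prime] (hp2 : p ≠ 2) {g : G}
    [hN : (Subgroup.zpowers g).Normal] (hord : orderOf g = p ^ k) (H : Subgroup G) :
    permChar H ∈ twoInflated (Subgroup.zpowers g) := by
  induction hc : Nat.card (Subgroup.zpowers g) - Nat.card (H ⊓ Subgroup.zpowers g : Subgroup G)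
    using Nat.strong_induction_on generalizing H with
  | _ c ih =>
  by_cases hg : g ∈ H
  · have hle : Subgroup.zpowers g ≤ H := by rwa [Subgroup.zpowers_le]
    have := permChar_eq_comp_mk (Subgroup.zpowers g) hle
    refine ⟨_, permChar_mem (H.map (QuotientGroup.mk' (Subgroup.zpowers g))), ?_, fun g _ _ => ?_⟩
    · rw [← this, sub_self]
      exact zero_mem _
    · exact congrFun this g
  obtain ⟨α, ℓ, E, hℓN, hℓH, hker, hE⟩ := exists_affineStep hN hord hg
  obtain ⟨n, hn⟩ : Nat.card (H.map α) ∣ p - 1 := by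
    have := (H.map α).card_subgroup_dvd_card
    rwa [Nat.card_eq_fintype_card (α := (ZMod p)ˣ), ZMod.card_units] at this
  have h1 := mem_twoInflated_of_memP (N := Subgroup.zpowers g) (hE.memP hp2 hn.symm)
    (hE.apply_eq_zero hp2 hn.symm)
  have hlt : ∀ J : Subgroup G, H ⊓ Subgroup.zpowers g ≤ J → ℓ ∈ J →
      permChar J ∈ twoInflated (Subgroup.zpowers g) := by
    intro J hJ hℓ
    refine ih _ ?_ J rfl
    have h2 : Nat.card (H ⊓ Subgroup.zpowers g : Subgroup G) <
        Nat.card (J ⊓ Subgroup.zpowers g : Subgroup G) := by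
      refine Set.Finite.card_lt_card (Set.toFinite _) ⟨fun x hx => ⟨hJ hx, hx.2⟩, fun h => ?_⟩
      exact hℓH (h ⟨hℓ, hℓN⟩).1
    have h3 : Nat.card (J ⊓ Subgroup.zpowers g : Subgroup G) ≤ Nat.card (Subgroup.zpowers g) :=
      Subgroup.card_le_of_le inf_le_right
    omega
  have h2 := hlt (H ⊔ Subgroup.zpowers ℓ) (inf_le_left.trans le_sup_left)
    (Subgroup.mem_sup_right (Subgroup.mem_zpowers ℓ))
  have h3 := hlt ((H ⊔ Subgroup.zpowers ℓ) ⊓ α.ker)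
    (le_inf (inf_le_left.trans le_sup_left) (inf_le_right.trans hker))
    ⟨Subgroup.mem_sup_right (Subgroup.mem_zpowers ℓ), hker hℓN⟩
  have := add_mem (add_mem h1 (nsmul_mem h3 n)) h2
  rwa [sub_add_cancel, sub_add_cancel] at this

theorem memP_of_odd {p k : ℕ} [Fact p.Prime] (hp2 : p ≠ 2) {g : G}
    [hN : (Subgroup.zpowers g).Normal] (hord : orderOf g = p ^ k)
    (hquot : ∀ χ : G ⧸ Subgroup.zpowers g → ℂ, MemS χ → MemP (G ⧸ Subgroup.zpowers g) χ)
    {χ : G → ℂ} (hχ : MemS χ) : MemP G χ := by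
  obtain ⟨h, h1, h2, h3⟩ := permGroup_le (permChar_mem_twoInflated hp2 hord)
    ((isPermChar_iff _).1 hχ.1)
  exact memP_of_eq_on_two_elements _ hquot hχ h1 h2 h3

end Chars

theorem Complex.two_mul_eq_sum_of_pow_eq_one {n : ℕ} (hn : 0 < n) {z : ℂ}
    (hz : z ^ (2 * n) = 1) :
    (2 * n : ℂ) * (if z = 1 then 1 else 0) = 1 + z ^ n +
      ∑ i ∈ Finset.range (n - 1), (z ^ (i + 1) + star (z ^ (i + 1)) - 2) + (2 * n - 2) := by
  obtain ⟨k, rfl⟩ : ∃ k, n = k + 1 := Nat.exists_eq_succ_of_ne_zero hn.ne'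
  have hnorm : ‖z‖ = 1 := Complex.norm_eq_one_of_pow_eq_one hz (by omega)
  have hz0 : z ≠ 0 := by
    rintro rfl
    simp at hnorm
  have hstar : ∀ i < k, star (z ^ (i + 1)) = z ^ (k + 2 + (k - 1 - i)) := by
    intro i hi
    have h1 : star z = z⁻¹ := by
      rw [Complex.inv_def, Complex.normSq_eq_norm_sq, hnorm]
      simp
    have h2 : z ^ (k + 2 + (k - 1 - i)) * z ^ (i + 1) = 1 := by
      rw [← pow_add, ← hz]
      congr 1
      omega
    rw [star_pow, h1, inv_pow]
    exact (eq_inv_of_mul_eq_one_left h2).symm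
  have h1 := Complex.sum_range_pow_of_pow_eq_one hz
  rw [show 2 * (k + 1) = k + 1 + 1 + k by omega, Finset.sum_range_add, Finset.sum_range_succ,
    Finset.sum_range_succ', ← Finset.sum_range_reflect (fun i => z ^ (k + 1 + 1 + i)) k] at h1
  rw [Nat.add_sub_cancel, Finset.sum_sub_distrib, Finset.sum_add_distrib,
    Finset.sum_congr rfl fun i hi => hstar i (Finset.mem_range.1 hi)]
  rw [mul_ite, mul_one, mul_zero]
  simp only [Finset.sum_const, Finset.card_range, nsmul_eq_mul]
  push_cast at h1 ⊢
  split_ifs at h1 ⊢ <;> linear_combination -h1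

namespace Chars

variable {G : Type} [Group G]

theorem central_of_odd_card_quotient [Finite G] {k : ℕ} {g : G} [hN : (Subgroup.zpowers g).Normal]
    (hord : orderOf g = 2 ^ k) (hodd : Odd (Nat.card (G ⧸ Subgroup.zpowers g))) (x : G) :
    x * g * x⁻¹ = g := by
  obtain ⟨m, hm⟩ := exists_conj_eq_zpow hN x
  obtain ⟨α, hα⟩ := exists_conjChar hN dvd_rfl
  have h1 : α x ^ Nat.card (G ⧸ Subgroup.zpowers g) = 1 := by
    have h2 : x ^ Nat.card (G ⧸ Subgroup.zpowers g) ∈ Subgroup.zpowers g := by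
      rw [← QuotientGroup.eq_one_iff, QuotientGroup.mk_pow, pow_card_eq_one']
    obtain ⟨i, hi⟩ := h2
    rw [← map_pow, ← hi]
    refine Units.ext ?_
    rw [hα _ 1 (by group), Int.cast_one, Units.val_one]
  have h2 : α x ^ 2 ^ (k - 1) = 1 := by
    rcases k.eq_zero_or_pos with rfl | hk
    · rw [pow_zero, orderOf_eq_one_iff] at hord
      subst hord
      refine Units.ext ?_
      simp [hα x 1 (by simp)]
    · have := ZMod.pow_totient (α x)
      rwa [show (orderOf g).totient = 2 ^ (k - 1) by
        rw [hord, Nat.totient_prime_pow Nat.prime_two hk, Nat.add_one_sub_one, mul_one]] at this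
  have h3 : α x = 1 := by
    rw [← orderOf_eq_one_iff]
    exact Nat.eq_one_of_dvd_coprimes (hodd.coprime_two_right.pow_right (k - 1))
      (orderOf_dvd_of_pow_eq_one h1) (orderOf_dvd_of_pow_eq_one h2)
  have h4 := hα x m hm
  rw [h3, Units.val_one, ← Int.cast_one, ZMod.intCast_eq_intCast_iff_dvd_sub,
    orderOf_dvd_iff_zpow_eq_one, zpow_sub, zpow_one, mul_inv_eq_one] at h4
  rw [hm, h4]

theorem permChar_bot_of_ne_one [Finite G] {g : G} (hg : g ≠ 1) : permChar (⊥ : Subgroup G) g = 0 := by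
  have := Fintype.ofFinite G
  rw [permChar_eq, Pi.smul_apply, conjSum_apply, Finset.sum_eq_zero, smul_zero]
  intro x _
  refine ind_of_notMem fun h => hg ?_
  have h1 : x * (x⁻¹ * g * x) * x⁻¹ = g := by group
  rw [← h1, Subgroup.mem_bot.1 h, mul_one, mul_inv_cancel]

theorem permChar_top (g : G) : permChar (⊤ : Subgroup G) g = 1 := by
  have : Subsingleton (G ⧸ (⊤ : Subgroup G)) := QuotientGroup.subsingleton_quotient_top
  have : Unique {x : G ⧸ (⊤ : Subgroup G) // g • x = x} :=
    ⟨⟨1, Subsingleton.elim _ _⟩, fun _ => Subsingleton.elim _ _⟩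
  simp [permChar]

theorem exists_signChar [Finite G] {g : G} (heven : Even (orderOf g))
    (hodd : Odd (Nat.card (G ⧸ Subgroup.zpowers g))) :
    ∃ ε : G →* ℂ, (∀ x, ε x = 1 ∨ ε x = -1) ∧ ε g = -1 := by
  obtain ⟨V, hV⟩ := exists_permRep (⊥ : Subgroup G)
  let W : FDRep ℂ G := matRep (1 : G →* Matrix (Fin (Nat.card G)) (Fin (Nat.card G)) ℂ)
  have hW : ∀ x, W.character x = Nat.card G := fun x => by
    rw [matRep_character]
    simp
  have key : ∀ x, ∃ c : ℤ, ∑ i ∈ Finset.range (orderOf x), (V.character - W.character) (x ^ i) =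
      orderOf x * c ∧ detChar V x = (-1) ^ c := by
    intro x
    obtain ⟨c, h1, h2⟩ := detChar_eq_of_real V W x (by rw [hW, hV, permChar_one]; simp)
      (fun x => by rw [hW, hV]; simp [permChar])
    refine ⟨c, h1, ?_⟩
    rw [h2, detChar_matRep]
    simp
  let ε : G →* ℂ := ⟨⟨detChar V, detChar_one V⟩, detChar_mul V⟩
  refine ⟨ε, fun x => ?_, ?_⟩
  · obtain ⟨c, -, hc⟩ := key x
    change detChar V x = 1 ∨ detChar V x = -1
    rw [hc]
    exact (Int.even_or_odd c).imp Even.neg_one_zpow Odd.neg_one_zpow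
  · obtain ⟨c, h1, hc⟩ := key g
    change detChar V g = -1
    rw [hc]
    refine Odd.neg_one_zpow ?_
    obtain ⟨o, ho⟩ : ∃ o, orderOf g = o + 1 := Nat.exists_eq_succ_of_ne_zero (orderOf_pos g).ne'
    have hcard : Nat.card G = Nat.card (G ⧸ Subgroup.zpowers g) * orderOf g := by
      rw [Subgroup.card_eq_card_quotient_mul_card_subgroup (Subgroup.zpowers g), Nat.card_zpowers]
    have h2 : ∑ i ∈ Finset.range (orderOf g), V.character (g ^ i) = Nat.card G := by
      rw [hV, ho, Finset.sum_range_succ', pow_zero, permChar_one, Finset.sum_eq_zero]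
      · simp
      · intro i hi
        refine permChar_bot_of_ne_one fun h => ?_
        have := Nat.le_of_dvd (by omega) (orderOf_dvd_of_pow_eq_one h)
        rw [Finset.mem_range] at hi
        omega
    simp only [Pi.sub_apply, Finset.sum_sub_distrib, h2, hW, Finset.sum_const, Finset.card_range,
      nsmul_eq_mul] at h1
    rw [hcard] at h1
    have h0 : (orderOf g : ℂ) ≠ 0 := by exact_mod_cast (orderOf_pos g).ne'
    have h3 : (orderOf g : ℂ) * (Nat.card (G ⧸ Subgroup.zpowers g) -
        Nat.card (G ⧸ Subgroup.zpowers g) * orderOf g) = orderOf g * c := by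
      rw [← h1]
      push_cast
      ring
    have h4 := mul_left_cancel₀ h0 h3
    have h5 : c = Nat.card (G ⧸ Subgroup.zpowers g) -
        Nat.card (G ⧸ Subgroup.zpowers g) * orderOf g := by exact_mod_cast h4.symm
    rw [h5]
    refine Odd.sub_even (by exact_mod_cast hodd) ?_
    exact_mod_cast heven.mul_left _

end Chars

namespace Chars

variable {G : Type} [Group G] [Finite G]

/-- The elements of `P_G` of degree zero containing the trivial character of `⟨g⟩` evenly often. -/
def evenPGroup (g : G) : AddSubgroup (G → ℂ) :=
  memPGroup G ⊓ (Pi.evalAddMonoidHom (fun _ : G => ℂ) 1).ker ⊓ evenAt g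

theorem selfConj_mem_evenPGroup (g : G) (V W : FDRep ℂ G) (hdeg : V.character 1 = W.character 1) :
    (V.character - W.character) + star (V.character - W.character) ∈ evenPGroup g := by
  refine ⟨⟨.selfConj V W hdeg, ?_⟩, selfConj_mem_evenAt V W g⟩
  change (V.character - W.character + star (V.character - W.character)) 1 = 0
  simp [hdeg]

omit [Finite G] in
theorem map_zpow_of_map_eq_neg_one {ε : G →* ℂ} {g : G} (h : ε g = -1) (i : ℤ) :
    ε (g ^ i) = (-1) ^ i := by
  have h2 : (Units.map ε (toUnits g)) = -1 := Units.ext h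
  have h3 : ε (g ^ i) = (Units.map ε (toUnits (g ^ i)) : ℂˣ) := rfl
  rw [h3, map_zpow, map_zpow, h2]
  simp

omit [Finite G] in
theorem signChar_eq_one_of_mem {k : ℕ} {g : G} [(Subgroup.zpowers g).Normal]
    (hord : orderOf g = 2 ^ k) (hodd : Odd (Nat.card (G ⧸ Subgroup.zpowers g)))
    {ε : G →* ℂ} (hε : ∀ x, ε x = 1 ∨ ε x = -1) (hεg : ε g = -1) {H : Subgroup G} (hg : g ∉ H)
    {h : G} (hh : h ∈ H) : ε h = 1 := by
  have h2 : h ^ Nat.card (G ⧸ Subgroup.zpowers g) ∈ Subgroup.zpowers g := by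
    rw [← QuotientGroup.eq_one_iff, QuotientGroup.mk_pow, pow_card_eq_one']
  obtain ⟨i, hi⟩ := h2
  have hi' : h ^ Nat.card (G ⧸ Subgroup.zpowers g) = g ^ i := hi.symm
  have heven : Even i := by
    by_contra hio
    rw [Int.not_even_iff_odd] at hio
    obtain ⟨c, hc⟩ := hio
    have hcop : IsCoprime i (2 : ℤ) := ⟨1, -c, by rw [hc]; ring⟩
    obtain ⟨a, b, hab⟩ := hcop.pow_right (n := k)
    refine hg ?_
    have h3 : g = (g ^ i) ^ a := by
      rw [← zpow_mul, mul_comm, eq_sub_of_add_eq hab, zpow_sub, zpow_one, mul_comm b, zpow_mul,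
        ← Nat.cast_ofNat, ← Nat.cast_pow, zpow_natCast, ← hord, pow_orderOf_eq_one]
      simp
    rw [h3, ← hi']
    exact zpow_mem (pow_mem hh _) a
  have h5 : ε h ^ Nat.card (G ⧸ Subgroup.zpowers g) = 1 := by
    rw [← map_pow, hi', map_zpow_of_map_eq_neg_one hεg, heven.neg_one_zpow]
  rcases hε h with h | h
  · exact h
  · rw [h, hodd.neg_one_pow] at h5
    norm_num at h5

omit [Finite G] in
theorem zpow_mem_iff_period_dvd (H : Subgroup G) (g : G) (i : ℤ) :
    g ^ i ∈ H ↔ (MulAction.period g ((1 : G) : G ⧸ H) : ℤ) ∣ i := by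
  rw [← MulAction.zpow_smul_eq_iff_period_dvd, MulAction.Quotient.smul_coe, eq_comm,
    QuotientGroup.eq]
  simp

omit [Finite G] in
theorem card_eq_mul_card {m : ℕ} [NeZero m] {H J : Subgroup G} (hle : H ≤ J) {E : G → ZMod m}
    (hE : ∀ x ∈ J, ∀ y ∈ J, E (x * y) = E x + E y) (hH : ∀ x ∈ J, E x = 0 ↔ x ∈ H)
    (hsurj : ∀ c, ∃ x ∈ J, E x = c) : Nat.card J = m * Nat.card H := by
  let f : J →* Multiplicative (ZMod m) :=
    MonoidHom.mk' (fun x => Multiplicative.ofAdd (E x)) fun x y => hE x x.2 y y.2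
  have h1 : f.ker = H.subgroupOf J := by
    ext x
    exact (hH x x.2)
  have h2 : Function.Surjective f := fun c => by
    obtain ⟨x, hx, hx'⟩ := hsurj c.toAdd
    exact ⟨⟨x, hx⟩, hx'⟩
  have h3 := f.ker.card_mul_index
  rw [Subgroup.index_ker, MonoidHom.range_eq_top.2 h2, Subgroup.card_top, h1,
    Nat.card_congr (Subgroup.subgroupOfEquivOfLe hle).toEquiv, Nat.card_congr Multiplicative.toAdd,
    Nat.card_zmod] at h3
  rw [← h3, mul_comm]

theorem exists_permChar_sub_mem_evenPGroup {k : ℕ} {g : G} [(Subgroup.zpowers g).Normal]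
    (hord : orderOf g = 2 ^ k) (hodd : Odd (Nat.card (G ⧸ Subgroup.zpowers g)))
    {ε : G →* ℂ} (hε : ∀ x, ε x = 1 ∨ ε x = -1) (hεg : ε g = -1) {H : Subgroup G} (hg : g ∉ H) :
    ∃ n : ℤ, permChar H - n • permChar (H ⊔ Subgroup.zpowers g) -
      ε * permChar (H ⊔ Subgroup.zpowers g) ∈ evenPGroup g := by
  set m := MulAction.period g ((1 : G) : G ⧸ H) with hm
  have hdvd : ∀ i : ℤ, g ^ i ∈ H ↔ (m : ℤ) ∣ i := zpow_mem_iff_period_dvd H g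
  have hm1 : m ∣ 2 ^ k := hord ▸ MulAction.period_dvd_orderOf g _
  have hm2 : m ≠ 1 := fun h => hg (by simpa using (hdvd 1).2 (by simp [h]))
  obtain ⟨n, hn⟩ : Even m := by
    obtain ⟨j, -, hj⟩ := (Nat.dvd_prime_pow Nat.prime_two).1 hm1
    rw [hj, Nat.even_pow]
    refine ⟨even_two, ?_⟩
    rintro rfl
    exact hm2 hj
  rw [← two_mul] at hn
  clear_value m
  subst hn
  have hn0 : 0 < n := by
    rcases n.eq_zero_or_pos with rfl | h
    · have := zero_dvd_iff.1 hm1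
      exact absurd this (by positivity)
    · exact h
  have : NeZero (2 * n) := ⟨by omega⟩
  have hJ : ∀ x, x ∈ H ⊔ Subgroup.zpowers g ↔ ∃ h ∈ H, ∃ i : ℤ, x = h * g ^ i := by
    intro x
    rw [Subgroup.mem_sup_of_normal_right]
    simp [Subgroup.mem_zpowers_iff, eq_comm]
  obtain ⟨E, hE⟩ := exists_exponent H g (2 * n) fun i => (hdvd i).1
  set J := H ⊔ Subgroup.zpowers g with hJdef
  have hmul : ∀ x ∈ J, ∀ y ∈ J, E (x * y) = E x + E y := by
    intro x hx y hy
    obtain ⟨a, ha, i, rfl⟩ := (hJ x).1 hx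
    obtain ⟨b, hb, l, rfl⟩ := (hJ y).1 hy
    have hc : g ^ i * b = b * g ^ i := by
      have h1 := central_of_odd_card_quotient hord hodd b
      have h2 : Commute b g := mul_inv_eq_iff_eq_mul.1 h1
      exact (h2.zpow_right i).symm.eq
    have e : a * g ^ i * (b * g ^ l) = a * b * g ^ (i + l) := by
      rw [zpow_add, mul_assoc, ← mul_assoc (g ^ i), hc]
      group
    rw [e, hE _ (mul_mem ha hb), hE _ ha, hE _ hb, Int.cast_add]
  have hEH : ∀ x ∈ J, E x = 0 ↔ x ∈ H := by
    intro x hx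
    obtain ⟨a, ha, i, rfl⟩ := (hJ x).1 hx
    rw [hE _ ha, H.mul_mem_cancel_left ha, hdvd, ZMod.intCast_zmod_eq_zero_iff_dvd]
  have hcard : Nat.card J = 2 * n * Nat.card H := by
    refine card_eq_mul_card le_sup_left hmul hEH fun c => ⟨g ^ (c.val : ℤ), ?_, ?_⟩
    · exact Subgroup.mem_sup_right (zpow_mem (Subgroup.mem_zpowers g) _)
    · simpa using hE 1 (one_mem H) c.val
  have hεE : ∀ x ∈ J, ε x = ZMod.stdAddChar (E x) ^ n := by
    intro x hx
    obtain ⟨a, ha, i, rfl⟩ := (hJ x).1 hx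
    have h1 := map_zpow_of_map_eq_neg_one hεg i
    have h4 : (ZMod.stdAddChar (1 : ZMod (2 * n)) : ℂ) ^ n = -1 := by
      have h5 := ZMod.stdAddChar_coe (N := 2 * n) 1
      rw [Int.cast_one] at h5
      rw [h5, ← Complex.exp_nat_mul, ← Complex.exp_pi_mul_I]
      congr 1
      have : (n : ℂ) ≠ 0 := by exact_mod_cast hn0.ne'
      push_cast
      field_simp
    rw [map_mul, signChar_eq_one_of_mem hord hodd hε hεg hg ha, h1, hE _ ha, one_mul]
    have h6 : (ZMod.stdAddChar ((i : ℤ) : ZMod (2 * n)) : ℂ) = ZMod.stdAddChar (1 : ZMod (2 * n)) ^ i := by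
      rw [← AddChar.map_zsmul_eq_zpow, zsmul_one]
    rw [h6, ← zpow_natCast, ← zpow_mul, mul_comm i, zpow_mul, zpow_natCast, h4]
  have key : (2 * n : ℂ) • ind H = ind J + ε * ind J +
      ∑ i ∈ Finset.range (n - 1), (linChar J E (i + 1 : ℕ) + star (linChar J E (i + 1 : ℕ)) -
        (2 : ℂ) • ind J) + (2 * n - 2 : ℂ) • ind J := by
    ext x
    simp only [Pi.add_apply, Pi.smul_apply, Pi.mul_apply, Finset.sum_apply, Pi.sub_apply,
      Pi.star_apply, smul_eq_mul]
    by_cases hx : x ∈ J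
    · have hpow : ∀ i : ℕ, linChar J E i x = ZMod.stdAddChar (E x) ^ i := by
        intro i
        rw [linChar_of_mem hx, ← nsmul_eq_mul, AddChar.map_nsmul_eq_pow]
      have h1 : (ZMod.stdAddChar (E x) : ℂ) ^ (2 * n) = 1 := by
        rw [← AddChar.map_nsmul_eq_pow, nsmul_eq_mul, ZMod.natCast_self, zero_mul,
          AddChar.map_zero_eq_one]
      have h2 : (ZMod.stdAddChar (E x) : ℂ) = 1 ↔ x ∈ H := by
        rw [← hEH x hx, ← AddChar.map_zero_eq_one (ZMod.stdAddChar (N := 2 * n)),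
          ZMod.injective_stdAddChar.eq_iff]
      have h3 := Complex.two_mul_eq_sum_of_pow_eq_one hn0 h1
      simp only [hpow, ind_of_mem hx, mul_one]
      rw [hεE x hx, ← h3]
      by_cases hxH : x ∈ H
      · rw [ind_of_mem hxH, if_pos (h2.2 hxH)]
      · rw [ind_of_notMem hxH, if_neg (mt h2.1 hxH)]
    · have hxH : x ∉ H := fun h => hx (Subgroup.mem_sup_left h)
      simp [ind_of_notMem hx, ind_of_notMem hxH, linChar_of_notMem hx]
  have hmem := sum_mem (S := evenPGroup g) (t := Finset.range (n - 1))
    (f := fun i => (Nat.card J : ℂ)⁻¹ • conjSum (linChar J E (i + 1 : ℕ) +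
      star (linChar J E (i + 1 : ℕ)) - (2 : ℂ) • ind J)) fun i _ => by
    obtain ⟨V, W, h1, h2⟩ := exists_selfConj_linChar (c := ((i + 1 : ℕ) : ZMod (2 * n))) hmul
    rw [h2]
    exact selfConj_mem_evenPGroup g V W h1
  refine ⟨2 * n - 1, ?_⟩
  convert hmem using 1
  have hH : permChar H = (Nat.card J : ℂ)⁻¹ • conjSum ((2 * n : ℂ) • ind H) := by
    have : (n : ℂ) ≠ 0 := by exact_mod_cast hn0.ne'
    have : (Nat.card H : ℂ) ≠ 0 := by exact_mod_cast Nat.card_pos.ne'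
    rw [permChar_eq, conjSum_smul, smul_smul, hcard]
    congr 1
    push_cast
    field_simp
  rw [hH, key, conjSum_add, conjSum_add, conjSum_add, conjSum_smul, conjSum_sum,
    conjSum_mul_class _ _ fun x g => ?_, permChar_eq J]
  · ext x
    simp only [Pi.add_apply, Pi.smul_apply, Pi.mul_apply, Finset.sum_apply, Pi.sub_apply,
      smul_eq_mul, zsmul_eq_mul, Pi.intCast_apply, Finset.mul_sum, mul_add]
    push_cast
    ring
  · rw [map_mul, map_mul, mul_right_comm, ← map_mul, inv_mul_cancel, map_one, one_mul]

end Chars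

namespace Chars

variable {G : Type} [Group G] [Finite G]

theorem not_odd_card_of_dihedral {Q : Type} [Group Q] (H : Subgroup Q) (K : Subgroup H)
    [K.Normal] (hquot : Nonempty (↥H ⧸ K ≃* Multiplicative (ZMod 2) × Multiplicative (ZMod 2)) ∨
      Nonempty (↥H ⧸ K ≃* DihedralGroup 4) ∨
      ∃ p : ℕ, p.Prime ∧ Odd p ∧ Nonempty (↥H ⧸ K ≃* DihedralGroup p)) :
    ¬ Odd (Nat.card Q) := by
  rw [Nat.not_odd_iff_even, even_iff_two_dvd]
  refine dvd_trans ?_ (K.card_quotient_dvd_card.trans H.card_subgroup_dvd_card)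
  rcases hquot with ⟨⟨e⟩⟩ | ⟨⟨e⟩⟩ | ⟨p, -, -, ⟨e⟩⟩
  · rw [Nat.card_congr e.toEquiv, Nat.card_prod, Nat.card_congr Multiplicative.toAdd, Nat.card_zmod]
    exact dvd_mul_right _ _
  · rw [Nat.card_congr e.toEquiv, DihedralGroup.nat_card]
    exact dvd_mul_right _ _
  · rw [Nat.card_congr e.toEquiv, DihedralGroup.nat_card]
    exact dvd_mul_right _ _

theorem mul_comp_mk_mem_evenPGroup (g : G) {N : Subgroup G} [N.Normal]
    (hodd : Odd (Nat.card (G ⧸ N))) {ε : G →* ℂ} (hε : ∀ x, ε x = 1 ∨ ε x = -1)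
    {f : G ⧸ N → ℂ} (hf : MemP (G ⧸ N) f) : (fun x : G => ε x * f x) ∈ evenPGroup g := by
  induction hf with
  | zero =>
    simp only [Pi.zero_apply, mul_zero]
    exact zero_mem _
  | add _ _ h1 h2 =>
    convert add_mem h1 h2 using 1
    ext x
    simp [mul_add]
  | zsmul n _ h =>
    convert zsmul_mem h n using 1
    ext x
    simp
    ring
  | selfConj V W hdeg =>
    have h := selfConj_mem_evenPGroup g (twist (QuotientGroup.mk' N) ε V)
      (twist (QuotientGroup.mk' N) ε W) (by simp only [twist_character, map_one, hdeg])
    convert h using 1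
    ext x
    have hs : star (ε x) = ε x := by rcases hε x with h | h <;> simp [h]
    simp only [Pi.add_apply, Pi.sub_apply, Pi.star_apply, twist_character, ← mul_sub, star_mul', hs]
    rw [← mul_add]
    rfl
  | dihedralInd H τ hdeg K hfac hquot => exact absurd hodd (not_odd_card_of_dihedral H K hquot)

theorem memP_of_odd_card {Q : Type} [Group Q] [Finite Q] (hodd : Odd (Nat.card Q))
    (hquot : ∀ χ : Q → ℂ, MemS χ → MemP Q χ) {h : Q → ℂ} (hperm : h ∈ permGroup Q)
    (hone : h 1 = 0) : MemP Q h := by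
  refine hquot _ ⟨(isPermChar_iff _).2 hperm, hone, hasTrivialDet_of_evenAt hperm hone ?_⟩
  intro x k hx
  have : x = 1 := by
    rw [← orderOf_eq_one_iff]
    exact Nat.eq_one_of_dvd_coprimes (hodd.coprime_two_right.pow_right k) (orderOf_dvd_natCard x)
      (orderOf_dvd_of_pow_eq_one hx)
  exact ⟨0, by simp [this, hone]⟩

/-- Functions which modulo `evenPGroup g` are the sum of a multiple of `ε` and of the inflation of
a permutation character of `G/N`. -/
def signInflated (g : G) (N : Subgroup G) [N.Normal] (ε : G →* ℂ) : AddSubgroup (G → ℂ) where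
  carrier := {χ | ∃ h ∈ permGroup (G ⧸ N), ∃ n : ℤ,
    (fun x : G => χ x - h x - n * ε x) ∈ evenPGroup g}
  zero_mem' := ⟨0, zero_mem _, 0, by
    convert zero_mem (evenPGroup g) using 1
    ext x
    simp⟩
  add_mem' := by
    rintro χ ψ ⟨h, h1, n, h2⟩ ⟨h', h1', n', h2'⟩
    refine ⟨h + h', add_mem h1 h1', n + n', ?_⟩
    convert add_mem h2 h2' using 1
    ext x
    simp only [Pi.add_apply, Int.cast_add]
    ring
  neg_mem' := by
    rintro χ ⟨h, h1, n, h2⟩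
    refine ⟨-h, neg_mem h1, -n, ?_⟩
    convert neg_mem h2 using 1
    ext x
    simp only [Pi.neg_apply, Int.cast_neg]
    ring

theorem permChar_mem_signInflated {k : ℕ} {g : G} [(Subgroup.zpowers g).Normal]
    (hord : orderOf g = 2 ^ k) (hodd : Odd (Nat.card (G ⧸ Subgroup.zpowers g)))
    (hquot : ∀ χ : G ⧸ Subgroup.zpowers g → ℂ, MemS χ → MemP (G ⧸ Subgroup.zpowers g) χ)
    {ε : G →* ℂ} (hε : ∀ x, ε x = 1 ∨ ε x = -1) (hεg : ε g = -1) (H : Subgroup G) :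
    permChar H ∈ signInflated g (Subgroup.zpowers g) ε := by
  have hle : ∀ J : Subgroup G, Subgroup.zpowers g ≤ J →
      permChar J ∈ signInflated g (Subgroup.zpowers g) ε := by
    intro J hJ
    refine ⟨_, permChar_mem (J.map (QuotientGroup.mk' (Subgroup.zpowers g))), 0, ?_⟩
    convert zero_mem (evenPGroup g) using 1
    ext x
    rw [permChar_eq_comp_mk (Subgroup.zpowers g) hJ]
    simp
  by_cases hg : g ∈ H
  · exact hle H (by rwa [Subgroup.zpowers_le])
  obtain ⟨n, hn⟩ := exists_permChar_sub_mem_evenPGroup hord hodd hε hεg hg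
  have hNJ : Subgroup.zpowers g ≤ H ⊔ Subgroup.zpowers g := le_sup_right
  set J := H ⊔ Subgroup.zpowers g
  set J' := J.map (QuotientGroup.mk' (Subgroup.zpowers g))
  have h1 : MemP _ (permChar J' - J'.index • permChar ⊤) := by
    refine memP_of_odd_card hodd hquot
      (sub_mem (permChar_mem _) (nsmul_mem (permChar_mem _) _)) ?_
    rw [Pi.sub_apply, Pi.smul_apply, permChar_one, permChar_top]
    simp
  have h2 := mul_comp_mk_mem_evenPGroup g hodd hε h1
  have h3 : permChar H - n • permChar J ∈ signInflated g (Subgroup.zpowers g) ε := by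
    refine ⟨0, zero_mem _, J'.index, ?_⟩
    convert add_mem hn h2 using 1
    ext x
    simp only [Pi.sub_apply, Pi.add_apply, Pi.mul_apply, Pi.zero_apply, Pi.smul_apply,
      permChar_top, permChar_eq_comp_mk (Subgroup.zpowers g) hNJ, J', Int.cast_natCast, nsmul_one,
      sub_zero]
    ring
  have := add_mem h3 (zsmul_mem (hle J hNJ) n)
  rwa [sub_add_cancel] at this

theorem memP_of_two {k : ℕ} {g : G} [(Subgroup.zpowers g).Normal]
    (hord : orderOf g = 2 ^ k) (hk : k ≠ 0) (hodd : Odd (Nat.card (G ⧸ Subgroup.zpowers g)))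
    (hquot : ∀ χ : G ⧸ Subgroup.zpowers g → ℂ, MemS χ → MemP (G ⧸ Subgroup.zpowers g) χ)
    {χ : G → ℂ} (hχ : MemS χ) : MemP G χ := by
  have heven : Even (orderOf g) := by
    rw [hord, Nat.even_pow]
    exact ⟨even_two, hk⟩
  obtain ⟨ε, hε, hεg⟩ := exists_signChar heven hodd
  obtain ⟨hχ1, hχ2, hχ3⟩ := hχ
  rw [isPermChar_iff] at hχ1
  obtain ⟨h, hperm, n, hP, hE⟩ :=
    permGroup_le (permChar_mem_signInflated hord hodd hquot hε hεg) hχ1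
  obtain ⟨a, ha⟩ := permGroup_one hperm
  have hP1 : MemP G fun x : G => χ x - h x - n * ε x := hP.1
  have hone : χ 1 - h ((1 : G) : G ⧸ Subgroup.zpowers g) - n * ε 1 = 0 := hP.2
  rw [hχ2, QuotientGroup.mk_one, ha, map_one, mul_one] at hone
  have hna : n = -a := by
    have : ((-a - n : ℤ) : ℂ) = 0 := by
      push_cast
      linear_combination hone
    have := Int.cast_eq_zero.1 this
    omega
  obtain ⟨z, hz⟩ := sub_mem (mem_evenAt_of_hasTrivialDet hχ3 hχ2 (permGroup_star hχ1) g) hE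
  have hz' : ∑ i ∈ Finset.range (orderOf g), ((a : ℂ) + n * (-1) ^ i) = orderOf g * (2 * z) := by
    rw [← hz]
    refine Finset.sum_congr rfl fun i _ => ?_
    have h1 : ((g ^ i : G) : G ⧸ Subgroup.zpowers g) = 1 := by
      rw [QuotientGroup.eq_one_iff]
      exact pow_mem (Subgroup.mem_zpowers g) i
    rw [Pi.sub_apply, h1, ha, map_pow, hεg]
    ring
  rw [Finset.sum_add_distrib, ← Finset.mul_sum, neg_one_geom_sum, if_pos heven, mul_zero, add_zero,
    Finset.sum_const, Finset.card_range, nsmul_eq_mul] at hz'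
  have haz : a = 2 * z := by
    have := mul_left_cancel₀ (by exact_mod_cast (orderOf_pos g).ne') hz'
    exact_mod_cast this
  have h1 : MemP _ (h - a • permChar ⊤) := by
    refine memP_of_odd_card hodd hquot (sub_mem hperm (zsmul_mem (permChar_mem _) _)) ?_
    rw [Pi.sub_apply, Pi.smul_apply, permChar_top, ha]
    simp
  obtain ⟨W, hW⟩ := exists_permRep (⊤ : Subgroup G)
  have h2 := MemP.selfConj (twist (MonoidHom.id G) ε W) W (by
    rw [twist_character, map_one, one_mul, MonoidHom.id_apply])
  have h3 := (hP1.add (memP_comp_mk _ h1)).add (h2.zsmul (-z))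
  convert h3 using 1
  ext x
  have hs : star (ε x) = ε x := by rcases hε x with h | h <;> simp [h]
  simp only [Pi.add_apply, Pi.sub_apply, Pi.smul_apply, Pi.star_apply, twist_character, hW,
    permChar_top, MonoidHom.id_apply, mul_one, star_sub, star_one, hs, hna, haz]
  simp only [zsmul_eq_mul]
  push_cast
  ring

end Chars

/-- If the `p`-Sylow subgroup `N` of `G` is normal and cyclic, and
`S_{G/N} ⊆ P_{G/N}`, then `S_G ⊆ P_G`. -/
theorem sylow_normal_cyclic_S_subset_P
    (G : Type) [Group G] [Finite G] (p : ℕ) (hp : p.Prime)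
    (N : Subgroup G) [N.Normal] (hcyc : IsCyclic N)
    (hSyl : ∃ P : Sylow p G, (P : Subgroup G) = N)
    (hquot : ∀ χ : G ⧸ N → ℂ, MemS χ → MemP (G ⧸ N) χ) :
    ∀ χ : G → ℂ, MemS χ → MemP G χ := by
  have := Fact.mk hp
  obtain ⟨P, hP⟩ := hSyl
  obtain ⟨k, hk⟩ := P.2.exists_card_eq
  have hndvd : ¬ p ∣ Nat.card (G ⧸ N) := by
    rw [← hP]
    exact P.not_dvd_index
  rw [hP] at hk
  obtain ⟨g, rfl⟩ := N.isCyclic_iff_exists_zpowers_eq_top.1 hcyc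
  rw [Nat.card_zpowers] at hk
  intro χ hχ
  by_cases hp2 : p = 2
  · subst hp2
    by_cases hk0 : k = 0
    · rw [hk0, pow_zero, ← pow_zero 3] at hk
      exact memP_of_odd (by decide) hk hquot hχ
    · refine memP_of_two hk hk0 ?_ hquot hχ
      rwa [← Nat.not_even_iff_odd, even_iff_two_dvd]
  · exact memP_of_odd hp2 hk hquot hχ
end
end

section
/- Let G be a finite group. For every ρ ∈ S_G there exist hyperelementary subgroups H_i ≤ G, characters ρ_i ∈ S_{H_i}, and integers n_i, such that ρ = Σ_i n_i · Ind_{H_i}^G ρ_i. -/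
open scoped BigOperators

noncomputable section

namespace Chars

/-- A finite group is hyperelementary if for some prime `p` it is an extension of a
normal cyclic group of order coprime to `p` by a `p`-group (equivalently, a semidirect
product `C ⋊ P` with `C` cyclic normal of order coprime to `p` and `P` a `p`-group). -/
def IsHyperelementary (H : Type) [Group H] : Prop :=
  ∃ p : ℕ, p.Prime ∧
    ∃ (C : Subgroup H) (_hn : C.Normal), IsCyclic C ∧
      ¬ (p ∣ Nat.card C) ∧ IsPGroup p (H ⧸ C)

/-- The number of fixed points of `g` on the `G`-set `X`, as a function of `g`. -/
def fixChar (G : Type) [Group G] (X : Type) [MulAction G X] : G → ℤ :=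
  fun g => (Nat.card {x : X // g • x = x} : ℤ)

lemma fixChar_quotient {G : Type} [Group G] (H : Subgroup G) (g : G) :
    ((fixChar G (G ⧸ H) g : ℤ) : ℂ) = permChar H g := by
  simp [fixChar, permChar]

lemma smul_mk_eq_iff {G : Type} [Group G] (H : Subgroup G) (g x : G) :
    g • (x : G ⧸ H) = x ↔ x⁻¹ * g * x ∈ H := by
  rw [MulAction.Quotient.smul_coe, eq_comm, QuotientGroup.eq, smul_eq_mul, mul_assoc]

lemma fixChar_prod {G : Type} [Group G] (X Y : Type) [MulAction G X] [MulAction G Y] :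
    fixChar G (X × Y) = fixChar G X * fixChar G Y := by
  funext g
  simp only [fixChar, Pi.mul_apply, ← Nat.cast_mul, ← Nat.card_prod]
  congr 1
  refine Nat.card_congr ⟨fun z => (⟨z.1.1, congrArg Prod.fst z.2⟩, ⟨z.1.2, congrArg Prod.snd z.2⟩),
    fun z => ⟨(z.1.1, z.2.1), Prod.ext z.1.2 z.2.2⟩, fun _ => rfl, fun _ => rfl⟩

open MulAction in
/-- A permutation character is the sum of the permutation characters of its orbits. -/
lemma fixChar_eq_sum_orbits {G : Type} [Group G] (X : Type) [MulAction G X] [Finite X]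
    [Fintype (orbitRel.Quotient G X)] :
    fixChar G X = ∑ ω : orbitRel.Quotient G X, fixChar G (G ⧸ stabilizer G ω.out) := by
  funext g
  simp only [fixChar, Finset.sum_apply]
  rw [← Nat.card_congr (Equiv.sigmaFiberEquiv
    fun x : {x : X // g • x = x} => (Quotient.mk'' x.1 : orbitRel.Quotient G X)),
    Nat.card_sigma, Nat.cast_sum]
  refine Finset.sum_congr rfl fun ω _ => congrArg _ (Eq.symm ?_)
  refine Nat.card_congr (Equiv.ofBijective (fun z => ⟨⟨ofQuotientStabilizer G ω.out z.1, ?_⟩, ?_⟩)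
    ⟨?_, ?_⟩)
  · rw [← ofQuotientStabilizer_smul, z.2]
  · conv_rhs => rw [← Quotient.out_eq' ω]
    exact Quotient.sound' (ofQuotientStabilizer_mem_orbit G ω.out z.1)
  · intro z w h
    exact Subtype.ext (injective_ofQuotientStabilizer G ω.out
      (congrArg (fun y => y.1.1) h))
  · rintro ⟨⟨x, hx⟩, h⟩
    have hmem : x ∈ orbit G ω.out := by
      rw [← orbitRel_apply]
      exact Quotient.exact' (h.trans (Quotient.out_eq' ω).symm)
    obtain ⟨a, rfl⟩ := hmem
    refine ⟨⟨(a : G ⧸ stabilizer G ω.out), ?_⟩, rfl⟩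
    apply injective_ofQuotientStabilizer G ω.out
    rw [ofQuotientStabilizer_smul]
    exact hx

/-- The `ℤ`-span of the characters `Ind_H^G 1` for `H` in a family `F` of subgroups. -/
def permSpan {G : Type} [Group G] (F : Set (Subgroup G)) : Submodule ℤ (G → ℤ) :=
  Submodule.span ℤ ((fun H : Subgroup G => fixChar G (G ⧸ H)) '' F)

lemma fixChar_mem_permSpan {G : Type} [Group G] (F : Set (Subgroup G)) (X : Type)
    [MulAction G X] [Finite X] (h : ∀ x : X, MulAction.stabilizer G x ∈ F) :
    fixChar G X ∈ permSpan F := by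
  have := Fintype.ofFinite (MulAction.orbitRel.Quotient G X)
  rw [fixChar_eq_sum_orbits]
  exact Submodule.sum_mem _ fun ω _ => Submodule.subset_span ⟨_, h _, rfl⟩

lemma mem_permSpan_iff {G : Type} [Group G] [Finite G] (F : Set (Subgroup G)) (f : G → ℤ) :
    f ∈ permSpan F ↔ ∃ (k : ℕ) (Hs : Fin k → Subgroup G) (ns : Fin k → ℤ),
      (∀ i, Hs i ∈ F) ∧ f = ∑ i, ns i • fixChar G (G ⧸ Hs i) := by
  constructor
  · intro h
    have := Fintype.ofFinite F
    rw [permSpan, Set.image_eq_range, Submodule.mem_span_range_iff_exists_fun] at h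
    obtain ⟨c, rfl⟩ := h
    let e := Fintype.equivFin F
    refine ⟨_, fun i => (e.symm i).1, fun i => c (e.symm i), fun i => (e.symm i).2, ?_⟩
    exact (Equiv.sum_comp e.symm fun H => c H • fixChar G (G ⧸ H.1)).symm
  · rintro ⟨k, Hs, ns, hF, rfl⟩
    exact Submodule.sum_mem _ fun i _ =>
      Submodule.smul_mem _ _ (Submodule.subset_span ⟨_, hF i, rfl⟩)

/-- The class of hyperelementary groups is closed under taking subgroups. -/
lemma IsHyperelementary.of_injective {H K : Type} [Group H] [Finite H] [Group K]
    (hH : IsHyperelementary H) (f : K →* H) (hf : Function.Injective f) :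
    IsHyperelementary K := by
  obtain ⟨p, hp, C, hn, hc, hd, hq⟩ := hH
  refine ⟨p, hp, C.comap f, inferInstance, ?_, ?_, ?_⟩
  · exact isCyclic_of_injective (f.subgroupComap C) fun a b h =>
      Subtype.ext (hf (congrArg Subtype.val h))
  · intro h
    refine hd (h.trans ?_)
    exact Subgroup.card_dvd_of_injective (f.subgroupComap C) fun a b h =>
      Subtype.ext (hf (congrArg Subtype.val h))
  · exact hq.of_injective (QuotientGroup.map (C.comap f) C f le_rfl)
      (by
        rw [← MonoidHom.ker_eq_bot_iff, QuotientGroup.ker_map]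
        simp)

lemma stabilizer_quotient_hyperelementary {G : Type} [Group G] [Finite G] {H K : Subgroup G}
    (hH : IsHyperelementary H) (x : G ⧸ H) (hK : K ≤ MulAction.stabilizer G x) :
    IsHyperelementary K := by
  induction x using QuotientGroup.induction_on with
  | H a =>
    have key : ∀ k : K, (MulAut.conj a⁻¹).toMonoidHom.comp K.subtype k ∈ H := fun k => by
      simpa using (smul_mk_eq_iff H k.1 a).1 (hK k.2)
    refine hH.of_injective (((MulAut.conj a⁻¹).toMonoidHom.comp K.subtype).codRestrict H key) ?_
    intro k l h
    have := congrArg Subtype.val h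
    exact Subtype.ext ((MulAut.conj a⁻¹).injective this)

/-- The hyperelementary subgroups of `G`. -/
def hyperelementarySubgroups (G : Type) [Group G] : Set (Subgroup G) :=
  {H | IsHyperelementary H}

lemma mul_mem_permSpan_hyperelementary {G : Type} [Group G] [Finite G] {f g : G → ℤ}
    (hf : f ∈ permSpan (hyperelementarySubgroups G))
    (hg : g ∈ permSpan (hyperelementarySubgroups G)) :
    f * g ∈ permSpan (hyperelementarySubgroups G) := by
  have h := Submodule.mul_mem_mul hf hg
  rw [permSpan, Submodule.span_mul_span] at h
  refine Submodule.span_le.2 ?_ h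
  rintro _ ⟨_, ⟨H, hH, rfl⟩, _, ⟨K, hK, rfl⟩, rfl⟩
  change fixChar G (G ⧸ H) * fixChar G (G ⧸ K) ∈ permSpan _
  rw [← fixChar_prod]
  refine fixChar_mem_permSpan _ _ fun x => ?_
  exact stabilizer_quotient_hyperelementary hH x.1 fun g hg => congrArg Prod.fst hg

/-- For every `x` and every prime `p` there is a hyperelementary subgroup `H` such that the
number of fixed points of `x` on `G ⧸ H` is prime to `p`. -/
lemma exists_hyperelementary_not_dvd {G : Type} [Group G] [Finite G] (x : G) (p : ℕ)
    [hp : Fact p.Prime] :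
    ∃ H ∈ hyperelementarySubgroups G, ¬ (p : ℤ) ∣ fixChar G (G ⧸ H) x := by
  obtain ⟨a, m, hm, hxm⟩ :=
    Nat.exists_eq_pow_mul_and_not_dvd (orderOf_pos x).ne' p hp.out.ne_one
  set c := x ^ p ^ a with hcx
  have hc : orderOf c = m := by
    rw [hcx, orderOf_pow_of_dvd (pow_ne_zero _ hp.out.ne_zero) (hxm ▸ dvd_mul_right _ _), hxm,
      Nat.mul_div_cancel_left _ (pow_pos hp.out.pos _)]
  let C : Subgroup G := Subgroup.zpowers c
  have hcC : c ∈ C := Subgroup.mem_zpowers c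
  let N : Subgroup G := Subgroup.normalizer C
  have hCN : C ≤ N := Subgroup.le_normalizer
  have hxN : x ∈ N := by
    have h : Subgroup.zpowers x ≤ N :=
      Subgroup.le_normalizer_of_normal_subgroupOf
        (H := C) (K := Subgroup.zpowers x)
        ((Subgroup.zpowers_le).2 (Subgroup.pow_mem _ (Subgroup.mem_zpowers x) _))
    exact h (Subgroup.mem_zpowers x)
  let C' : Subgroup N := C.subgroupOf N
  have : C'.Normal := Subgroup.normal_in_normalizer
  let π := QuotientGroup.mk' C'
  have hπ : Function.Surjective π := QuotientGroup.mk'_surjective C'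
  let P : Sylow p (N ⧸ C') := default
  let H' : Subgroup N := (P : Subgroup (N ⧸ C')).comap π
  let H : Subgroup G := H'.map N.subtype
  have hC'H' : C' ≤ H' := fun z hz => by
    change π z ∈ (P : Subgroup (N ⧸ C'))
    have h1 : π z = 1 := (QuotientGroup.eq_one_iff z).2 hz
    exact h1 ▸ one_mem _
  have hCH : C ≤ H := fun z hz => ⟨⟨z, hCN hz⟩, hC'H' hz, rfl⟩
  have hHN : H ≤ N := Subgroup.map_subtype_le _
  have hpow : ∀ h ∈ H, ∃ k : ℕ, h ^ p ^ k ∈ C := by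
    rintro _ ⟨n, hn, rfl⟩
    obtain ⟨k, hk⟩ := P.2 ⟨π n, hn⟩
    refine ⟨k, ?_⟩
    have h1 : π (n ^ p ^ k) = 1 := by
      rw [map_pow]
      exact congrArg Subtype.val hk
    exact (QuotientGroup.eq_one_iff (N := C') (n ^ p ^ k)).1 h1
  have hindex : ¬ p ∣ H'.index := by
    rw [Subgroup.index_comap_of_surjective _ hπ]
    exact P.not_dvd_index
  have hnormal : (C.subgroupOf H).Normal :=
    (Subgroup.normal_subgroupOf_iff_le_normalizer hCH).2 hHN
  refine ⟨H, ⟨p, hp.out, C.subgroupOf H, hnormal, ?_, ?_, ?_⟩, ?_⟩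
  · exact isCyclic_of_injective (Subgroup.subgroupOfEquivOfLe hCH).toMonoidHom
      (Subgroup.subgroupOfEquivOfLe hCH).injective
  · rw [Nat.card_congr (Subgroup.subgroupOfEquivOfLe hCH).toEquiv, Nat.card_zpowers, hc]
    exact hm
  · intro q
    induction q using QuotientGroup.induction_on with
    | H h =>
      obtain ⟨k, hk⟩ := hpow h h.2
      exact ⟨k, (QuotientGroup.eq_one_iff (h ^ p ^ k)).2 hk⟩
  -- An element conjugating `x` into `H` normalizes `C`.
  have hconj : ∀ y : G, y⁻¹ * x * y ∈ H → y ∈ N := by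
    intro y hy
    have hy' : y⁻¹ * c * y ∈ H := by
      have h := H.pow_mem hy (p ^ a)
      have h2 : (y⁻¹ * x * y) ^ p ^ a = y⁻¹ * c * y := by
        simpa using conj_pow (a := y⁻¹) (b := x) (i := p ^ a)
      rwa [h2] at h
    have hyC : y⁻¹ * c * y ∈ C := by
      obtain ⟨k, hk⟩ := hpow _ hy'
      have ho : orderOf (y⁻¹ * c * y) = m := by
        rw [← hc]
        simpa using orderOf_injective (MulAut.conj y⁻¹).toMonoidHom (MulAut.conj y⁻¹).injective c
      obtain ⟨l, hl⟩ := exists_pow_eq_self_of_coprime (n := p ^ k) (x := y⁻¹ * c * y)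
        (ho ▸ Nat.Coprime.pow_left _ ((Nat.Prime.coprime_iff_not_dvd hp.out).2 hm))
      rw [← hl]
      exact C.pow_mem hk l
    have hle : C.map (MulAut.conj y⁻¹).toMonoidHom ≤ C := by
      rw [MonoidHom.map_zpowers, Subgroup.zpowers_le]
      simpa using hyC
    have heq : C.map (MulAut.conj y⁻¹).toMonoidHom = C :=
      Subgroup.eq_of_le_of_card_ge hle (Subgroup.card_map_of_injective
        (MulAut.conj y⁻¹).injective).ge
    exact inv_mem_iff.1 (Subgroup.mem_normalizer_iff_map_conj_eq.2 heq)
  let O := MulAction.orbit N ((1 : G) : G ⧸ H)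
  have hO : Nat.card O = H'.index := by
    have hs : MulAction.stabilizer N ((1 : G) : G ⧸ H) = H' := by
      ext n
      have h := smul_mk_eq_iff H n.1 1
      rw [MulAction.mem_stabilizer_iff]
      refine h.trans ?_
      simp [H]
    rw [← hs, MulAction.index_stabilizer, Nat.card_coe_set_eq]
  let f : Function.End O := MulAction.toEndHom (⟨x, hxN⟩ : N)
  have hf : f ^ p ^ a = 1 := by
    rw [← map_pow]
    funext z
    obtain ⟨_, n, rfl⟩ := z
    apply Subtype.ext
    change c • ((n.1 * 1 : G) : G ⧸ H) = ((n.1 * 1 : G) : G ⧸ H)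
    rw [smul_mk_eq_iff, mul_one]
    exact hCH ((Subgroup.mem_normalizer_iff''.1 n.2 c).1 hcC)
  classical
  have := Fintype.ofFinite O
  have hmod : Nat.card O ≡ Nat.card f.fixedPoints [MOD p] := by
    simpa only [Fintype.card_eq_nat_card] using Equiv.Perm.card_fixedPoints_modEq hf
  have hfix : Nat.card {z : G ⧸ H // x • z = z} = Nat.card f.fixedPoints := by
    refine (Nat.card_congr (Equiv.ofBijective
      (fun z : f.fixedPoints => ⟨z.1.1, congrArg Subtype.val z.2⟩) ⟨?_, ?_⟩)).symm
    · intro z w h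
      exact Subtype.ext (Subtype.ext (congrArg (fun u => u.1) h))
    · rintro ⟨z, hz⟩
      induction z using QuotientGroup.induction_on with
      | H y =>
        have hyN := hconj y ((smul_mk_eq_iff H x y).1 hz)
        refine ⟨⟨⟨(y : G ⧸ H), ⟨⟨y, hyN⟩, ?_⟩⟩, Subtype.ext hz⟩, rfl⟩
        exact congrArg _ (mul_one y)
  rw [fixChar, hfix, Int.natCast_dvd_natCast, ← Nat.modEq_zero_iff_dvd]
  intro h0
  rw [hO] at hmod
  exact hindex ((Nat.modEq_zero_iff_dvd).1 (hmod.trans h0))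

/-- Solomon's induction theorem: the trivial character is an integral linear combination of
characters `Ind_H^G 1` with `H` hyperelementary. -/
lemma one_mem_permSpan_hyperelementary (G : Type) [Group G] [Finite G] :
    (1 : G → ℤ) ∈ permSpan (hyperelementarySubgroups G) := by
  classical
  set R := permSpan (hyperelementarySubgroups G) with hR
  have hloc : ∀ x : G, ∃ f ∈ R, f x = 1 := by
    intro x
    let I : Ideal ℤ := R.map (LinearMap.proj x : (G → ℤ) →ₗ[ℤ] ℤ)
    have hI : I = ⊤ := by
      by_contra hne
      obtain ⟨d, hd⟩ := (IsPrincipalIdealRing.principal I).principal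
      have hdu : d.natAbs ≠ 1 := fun h =>
        hne (hd.trans (Ideal.span_singleton_eq_top.2 (Int.isUnit_iff_natAbs_eq.2 h)))
      obtain ⟨p, hp, hpd⟩ := Nat.exists_prime_and_dvd hdu
      have := Fact.mk hp
      obtain ⟨H, hH, hndvd⟩ := exists_hyperelementary_not_dvd x p
      have hmem : fixChar G (G ⧸ H) x ∈ I := ⟨_, Submodule.subset_span ⟨H, hH, rfl⟩, rfl⟩
      rw [hd] at hmem
      exact hndvd ((Int.natCast_dvd.2 hpd).trans (Ideal.mem_span_singleton.1 hmem))
    have h1 : (1 : ℤ) ∈ I := hI ▸ Submodule.mem_top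
    exact h1
  choose f hfR hf1 using hloc
  have := Fintype.ofFinite G
  have hprod : ∀ s : Finset G, 1 - ∏ x ∈ s, (1 - f x) ∈ R := by
    intro s
    induction s using Finset.induction_on with
    | empty => simp
    | insert y s hy ih =>
      rw [Finset.prod_insert hy, show 1 - (1 - f y) * ∏ x ∈ s, (1 - f x) =
        (1 - ∏ x ∈ s, (1 - f x)) + f y - f y * (1 - ∏ x ∈ s, (1 - f x)) by ring]
      exact R.sub_mem (R.add_mem ih (hfR y)) (mul_mem_permSpan_hyperelementary (hfR y) ih)
  have hzero : ∏ x : G, (1 - f x) = 0 := by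
    funext g
    rw [Finset.prod_apply]
    exact Finset.prod_eq_zero (Finset.mem_univ g) (by simp [hf1])
  simpa [hzero] using hprod Finset.univ

lemma isPermChar_iff_s17 {G : Type} [Group G] [Finite G] (χ : G → ℂ) :
    IsPermChar χ ↔ ∃ f ∈ permSpan (Set.univ : Set (Subgroup G)), χ = fun g => (f g : ℂ) := by
  constructor
  · rintro ⟨k, Hs, ns, rfl⟩
    refine ⟨_, (mem_permSpan_iff _ _).2 ⟨k, Hs, ns, fun _ => Set.mem_univ _, rfl⟩, ?_⟩
    funext g
    simp [fixChar_quotient]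
  · rintro ⟨f, hf, rfl⟩
    obtain ⟨k, Hs, ns, -, rfl⟩ := (mem_permSpan_iff _ _).1 hf
    refine ⟨k, Hs, ns, ?_⟩
    funext g
    simp [fixChar_quotient]

lemma IsPermChar.restrict {G : Type} [Group G] [Finite G] {χ : G → ℂ} (hχ : IsPermChar χ)
    (K : Subgroup G) : IsPermChar fun k : K => χ k := by
  obtain ⟨k, Hs, ns, rfl⟩ := hχ
  rw [isPermChar_iff_s17]
  refine ⟨∑ i, ns i • fixChar K (G ⧸ Hs i), ?_, ?_⟩
  · exact Submodule.sum_mem _ fun i _ => Submodule.smul_mem _ _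
      (fixChar_mem_permSpan _ _ fun _ => Set.mem_univ _)
  · funext g
    simp only [Finset.sum_apply, Pi.smul_apply, smul_eq_mul, Int.cast_sum, Int.cast_mul]
    refine Finset.sum_congr rfl fun i _ => ?_
    rw [← fixChar_quotient]
    rfl

lemma HasTrivialDet.restrict {G : Type} [Group G] {χ : G → ℂ} (hχ : HasTrivialDet χ)
    (K : Subgroup G) : HasTrivialDet fun k : K => χ k := by
  obtain ⟨V, W, rfl, hdet⟩ := hχ
  exact ⟨FDRep.of (V.ρ.comp K.subtype), FDRep.of (W.ρ.comp K.subtype), rfl, fun g => hdet g⟩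

lemma MemS.restrict {G : Type} [Group G] [Finite G] {χ : G → ℂ} (hχ : MemS χ)
    (K : Subgroup G) : MemS fun k : K => χ k :=
  ⟨hχ.1.restrict K, hχ.2.1, hχ.2.2.restrict K⟩

lemma HasTrivialDet.conj_apply {G : Type} [Group G] {χ : G → ℂ} (hχ : HasTrivialDet χ)
    (g x : G) : χ (x⁻¹ * g * x) = χ g := by
  obtain ⟨V, W, rfl, -⟩ := hχ
  have key (U : FDRep ℂ G) : U.character (x⁻¹ * g * x) = U.character g := by
    rw [FDRep.char_mul_comm, mul_inv_cancel_left]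
  simp [key]

lemma card_conj_mem {G : Type} [Group G] [Finite G] (H : Subgroup G) (g : G) :
    Nat.card {x : G // x⁻¹ * g * x ∈ H} =
      Nat.card H * Nat.card {z : G ⧸ H // g • z = z} := by
  rw [← Nat.card_prod]
  refine (Nat.card_congr (Equiv.subtypeEquivRight fun x => ?_)).trans
    (Nat.card_congr (QuotientGroup.preimageMkEquivSubgroupProdSet H {z : G ⧸ H | g • z = z}))
  exact (smul_mk_eq_iff H g x).symm

/-- The projection formula `Ind_H^G (Res_H χ) = χ * Ind_H^G 1`. -/
lemma indChar_restrict {G : Type} [Group G] [Finite G] (H : Subgroup G) {χ : G → ℂ}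
    (hχ : ∀ g x, χ (x⁻¹ * g * x) = χ g) (g : G) :
    indChar H (fun h : H => χ h) g = χ g * permChar H g := by
  classical
  have := Fintype.ofFinite G
  have hH : (Nat.card H : ℂ) ≠ 0 := Nat.cast_ne_zero.2 Nat.card_pos.ne'
  have hsum : (∑ᶠ x : G, if h : x⁻¹ * g * x ∈ H then χ (x⁻¹ * g * x) else 0) =
      (Nat.card {x : G // x⁻¹ * g * x ∈ H} : ℂ) * χ g := by
    rw [finsum_eq_sum_of_fintype]
    simp only [hχ, dite_eq_ite]
    rw [← Finset.sum_filter, Finset.sum_const, nsmul_eq_mul, Nat.card_eq_fintype_card,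
      Fintype.card_subtype]
  rw [indChar]
  refine (congrArg _ hsum).trans ?_
  rw [card_conj_mem, permChar]
  push_cast
  field_simp

end Chars

open Chars

/-- Every `ρ ∈ S_G` is an integral linear combination of characters
induced from elements of `S_{H_i}` for hyperelementary subgroups `H_i ≤ G`. -/
theorem memS_induced_from_hyperelementary
    (G : Type) [Group G] [Finite G] (χ : G → ℂ) (hχ : MemS χ) :
    ∃ (k : ℕ) (Hs : Fin k → Subgroup G) (ρs : ∀ i, ↥(Hs i) → ℂ) (ns : Fin k → ℤ),
      (∀ i, IsHyperelementary ↥(Hs i)) ∧ (∀ i, MemS (ρs i)) ∧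
      χ = fun g => ∑ i, (ns i : ℂ) * indChar (Hs i) (ρs i) g := by
  obtain ⟨k, Hs, ns, hF, h1⟩ :=
    (mem_permSpan_iff _ _).1 (one_mem_permSpan_hyperelementary G)
  refine ⟨k, Hs, fun i h => χ h, ns, hF, fun i => hχ.restrict (Hs i), ?_⟩
  funext g
  have hg : (1 : ℂ) = ∑ i, (ns i : ℂ) * permChar (Hs i) g := by
    have h := congrArg (Int.cast : ℤ → ℂ) (congrFun h1 g)
    simpa [fixChar_quotient] using h
  simp only [indChar_restrict _ hχ.2.2.conj_apply]
  calc χ g = χ g * 1 := (mul_one _).symm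
    _ = _ := by
      rw [hg, Finset.mul_sum]
      exact Finset.sum_congr rfl fun i _ => by ring
end
end
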